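/- arXiv:1601.08231 — 3 statements merged into one kernel-verified Lean document; each statement's English description precedes it below -/
import Mathlib

section
/- The generalized nil-Coxeter algebra NC_A(n,d) is a free module over the base ring k of rank n!·(1 + n(d-1)), with basis {T_w : w ∈ S_n} ∪ {T_w T_n^k T_{n-1} T_{n-2} ⋯ T_m : w ∈ S_n, 1 ≤ k ≤ d-1, 1 ≤ m ≤ n}. -/
/-- Relations of the generalized nil-Coxeter algebra `NC_A(n,d)` on generators
`T_1, …, T_n` (0-indexed by `Fin n`): type-`A_n` braid relations,
`T_i^2 = 0` for `i < n`, and `T_n^d = 0`. -/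
inductive NCRel (k : Type) [CommRing k] (n d : ℕ) :
    FreeAlgebra k (Fin n) → FreeAlgebra k (Fin n) → Prop
  | braid (i j : Fin n) (h : (i : ℕ) + 1 = j) :
      NCRel k n d (FreeAlgebra.ι k i * FreeAlgebra.ι k j * FreeAlgebra.ι k i)
        (FreeAlgebra.ι k j * FreeAlgebra.ι k i * FreeAlgebra.ι k j)
  | comm (i j : Fin n) (h : (i : ℕ) + 1 < j) :
      NCRel k n d (FreeAlgebra.ι k i * FreeAlgebra.ι k j)
        (FreeAlgebra.ι k j * FreeAlgebra.ι k i)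
  | sq (i : Fin n) (h : (i : ℕ) + 1 < n) : NCRel k n d (FreeAlgebra.ι k i ^ 2) 0
  | last (i : Fin n) (h : (i : ℕ) + 1 = n) : NCRel k n d (FreeAlgebra.ι k i ^ d) 0

/-- The generalized nil-Coxeter algebra `NC_A(n,d)`. -/
abbrev NCA (k : Type) [CommRing k] (n d : ℕ) := RingQuot (NCRel k n d)

/-- The generator `T_j` (1-indexed, for `1 ≤ j ≤ n`) of `NC_A(n,d)`. -/
noncomputable def Tg (k : Type) [CommRing k] (n d : ℕ) (j : ℕ) : NCA k n d :=
  if h : 1 ≤ j ∧ j ≤ n then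
    RingQuot.mkAlgHom k (NCRel k n d) (FreeAlgebra.ι k ⟨j - 1, by omega⟩) else 1

/-- The descending product `T_{n-1} T_{n-2} ⋯ T_m` in `NC_A(n,d)`. -/
noncomputable def descT (k : Type) [CommRing k] (n d : ℕ) (m : ℕ) : NCA k n d :=
  ((List.range' m (n - m)).reverse.map (Tg k n d)).prod

/-- The product of generators `T_{j}` along a (1-indexed) word `l`. -/
noncomputable def TwOf (k : Type) [CommRing k] (n d : ℕ) (l : List ℕ) : NCA k n d :=
  (l.map (Tg k n d)).prod

/-- The simple transposition `s_j = (j, j+1)` (1-indexed) in the symmetric group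
on `{1, …, n}`, realized as `Equiv.Perm (Fin n)`. -/
def sp (n : ℕ) (j : ℕ) : Equiv.Perm (Fin n) :=
  if h : 1 ≤ j ∧ j < n then Equiv.swap ⟨j - 1, by omega⟩ ⟨j, h.2⟩ else 1

/-- `l` is a reduced word for `w ∈ S_n` in the simple transpositions `s_1, …, s_{n-1}`. -/
def IsRedWord (n : ℕ) (w : Equiv.Perm (Fin n)) (l : List ℕ) : Prop :=
  (∀ j ∈ l, 1 ≤ j ∧ j < n) ∧ (l.map (sp n)).prod = w ∧
    ∀ l' : List ℕ, (∀ j ∈ l', 1 ≤ j ∧ j < n) → (l'.map (sp n)).prod = w →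
      l.length ≤ l'.length

/-- The candidate basis of `NC_A(n,d)`: the words `T_w` for `w ∈ S_n`, together with
`T_w T_n^k T_{n-1} ⋯ T_m` for `w ∈ S_n`, `1 ≤ k ≤ d-1`, `1 ≤ m ≤ n`
(here `k = k0+1`, `m = m0+1` for `k0 : Fin (d-1)`, `m0 : Fin n`). -/
noncomputable def ncaFam (k : Type) [CommRing k] (n d : ℕ)
    (rw : Equiv.Perm (Fin n) → List ℕ) :
    Equiv.Perm (Fin n) ⊕ Equiv.Perm (Fin n) × Fin (d - 1) × Fin n → NCA k n d
  | .inl w => TwOf k n d (rw w)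
  | .inr (w, k0, m0) =>
      TwOf k n d (rw w) * Tg k n d n ^ ((k0 : ℕ) + 1) * descT k n d ((m0 : ℕ) + 1)


/-! ### Permutations, descents and reduced words -/

/-- The value of `w` at position `a`, as a natural number. -/
def wv {n : ℕ} (w : Equiv.Perm (Fin n)) (a : ℕ) : ℕ := if h : a < n then (w ⟨a, h⟩ : ℕ) else 0

lemma wv_inj {n : ℕ} (w : Equiv.Perm (Fin n)) {a b : ℕ} (ha : a < n) (hb : b < n)
    (h : wv w a = wv w b) : a = b := by
  simp only [wv, ha, hb, dif_pos] at h
  have := w.injective (Fin.ext h)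
  simpa using this

lemma wv_one {n : ℕ} {a : ℕ} (ha : a < n) : wv (1 : Equiv.Perm (Fin n)) a = a := by
  simp [wv, ha]

lemma wv_ext {n : ℕ} {w v : Equiv.Perm (Fin n)} (h : ∀ a < n, wv w a = wv v a) : w = v := by
  ext ⟨a, ha⟩
  simpa [wv, ha] using h a ha

lemma wv_mul_sp {n : ℕ} (w : Equiv.Perm (Fin n)) {i : ℕ} (h1 : 1 ≤ i) (h2 : i < n) (a : ℕ) :
    wv (w * sp n i) a = if a = i - 1 then wv w i else if a = i then wv w (i - 1) else wv w a := by
  have h3 : i - 1 < n := by omega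
  by_cases ha : a < n
  · simp only [wv, ha, h2, h3, dif_pos, Equiv.Perm.mul_apply, sp, h1, and_self,
      Equiv.swap_apply_def, Fin.mk.injEq]
    split_ifs <;> rfl
  · have e1 : a ≠ i - 1 := by omega
    have e2 : a ≠ i := by omega
    simp [wv, ha, e1, e2]

lemma sp_sq {n : ℕ} (w : Equiv.Perm (Fin n)) (i : ℕ) : w * sp n i * sp n i = w := by
  unfold sp
  split_ifs <;> simp [mul_assoc]

lemma sp_comm {n : ℕ} (w : Equiv.Perm (Fin n)) {i j : ℕ} (hi : 1 ≤ i) (hj : j < n)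
    (h : i + 1 < j) : w * sp n i * sp n j = w * sp n j * sp n i := by
  apply wv_ext
  intro a ha
  have a1 : 1 ≤ j := by omega
  have a2 : i < n := by omega
  simp only [wv_mul_sp _ hi a2, wv_mul_sp _ a1 hj]
  split_ifs <;> first | rfl | omega

lemma sp_braid {n : ℕ} (w : Equiv.Perm (Fin n)) {i : ℕ} (hi : 1 ≤ i) (hj : i + 1 < n) :
    w * sp n i * sp n (i + 1) * sp n i = w * sp n (i + 1) * sp n i * sp n (i + 1) := by
  obtain ⟨p, rfl⟩ : ∃ p, i = p + 1 := ⟨i - 1, by omega⟩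
  apply wv_ext
  intro a ha
  have a1 : 1 ≤ p + 1 + 1 := by omega
  have a2 : p + 1 < n := by omega
  simp only [wv_mul_sp _ hi a2, wv_mul_sp _ a1 hj, Nat.add_sub_cancel]
  have e1 : p + 1 + 1 ≠ p := by omega
  have e2 : p ≠ p + 1 + 1 := by omega
  by_cases h0 : a = p
  · subst h0; simp [e1, e2]
  by_cases h1 : a = p + 1
  · subst h1; simp [e1, e2]
  by_cases h2 : a = p + 1 + 1
  · subst h2; simp [e1, e2]
  simp [h0, h1, h2]

/-- `Red l w`: reading `l` strips descents of `w` one at a time, ending in the identity. -/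
def Red {n : ℕ} : List ℕ → Equiv.Perm (Fin n) → Prop
  | [], w => w = 1
  | i :: l, w => 1 ≤ i ∧ i < n ∧ wv w i < wv w (i - 1) ∧ Red l (w * sp n i)

lemma exists_descent {n : ℕ} (w : Equiv.Perm (Fin n)) (hw : w ≠ 1) :
    ∃ i, 1 ≤ i ∧ i < n ∧ wv w i < wv w (i - 1) := by
  by_contra hc
  push Not at hc
  apply hw
  have hm : StrictMono w := by
    obtain _ | n := n
    · intro a; exact a.elim0
    rw [Fin.strictMono_iff_lt_succ]
    intro i
    have h := hc (i + 1) (by omega) (by omega)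
    have h' : wv w (i + 1 - 1) ≠ wv w (i + 1) := by
      intro he
      have := wv_inj w (by omega) (by omega) he
      omega
    have h2 : wv w (i + 1 - 1) < wv w (i + 1) := lt_of_le_of_ne h h'
    have e1 : (i : ℕ) < n + 1 := by omega
    simp only [wv, Nat.add_sub_cancel, e1, dif_pos, Nat.add_lt_add_iff_right, i.2] at h2
    exact h2
  have := Subsingleton.elim (hm.orderIsoOfSurjective w w.surjective) (OrderIso.refl _)
  ext a
  have := congrArg (fun f : Fin n ≃o Fin n => f a) this
  simpa using congrArg Fin.val this

lemma exists_red {n : ℕ} (w : Equiv.Perm (Fin n)) : ∃ l, Red l w := by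
  have wf : WellFounded (fun a b : Lex (Fin n → Fin n) => a < b) := wellFounded_lt
  have key : ∀ x : Lex (Fin n → Fin n), ∀ w : Equiv.Perm (Fin n), toLex (w : Fin n → Fin n) = x →
      ∃ l, Red l w := by
    intro x
    induction x using wf.induction with
    | _ x ih =>
      intro w hx
      by_cases hw : w = 1
      · exact ⟨[], hw⟩
      obtain ⟨i, h1, h2, h3⟩ := exists_descent w hw
      obtain ⟨l, hl⟩ := ih (toLex (w * sp n i : Equiv.Perm (Fin n))) (by
        subst hx
        have h4 : i - 1 < n := by omega
        refine ⟨⟨i - 1, by omega⟩, ?_, ?_⟩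
        · intro a ha
          have ha' : (a : ℕ) < i - 1 := ha
          have := wv_mul_sp w h1 h2 a
          rw [if_neg (by omega), if_neg (by omega)] at this
          simp only [wv, a.2, dif_pos] at this
          exact Fin.ext this
        · have := wv_mul_sp w h1 h2 (i - 1)
          rw [if_pos rfl] at this
          rw [← this] at h3
          simp only [wv, h4, dif_pos] at h3
          exact h3) _ rfl
      exact ⟨i :: l, h1, h2, h3, hl⟩
  exact key _ w rfl

/-- Product along a reversed word. -/
def rval {A : Type*} [Monoid A] (T : ℕ → A) : List ℕ → A
  | [] => 1
  | i :: l => rval T l * T i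

lemma not_desc_one {n i : ℕ} (h1 : 1 ≤ i) (h2 : i < n)
    (h : wv (1 : Equiv.Perm (Fin n)) i < wv (1 : Equiv.Perm (Fin n)) (i - 1)) : False := by
  rw [wv_one h2, wv_one (by omega)] at h
  omega

/-- Matsumoto's theorem in type A. -/
lemma matsumoto {A : Type*} [Monoid A] (n : ℕ) (T : ℕ → A)
    (hb : ∀ i, 1 ≤ i → i + 1 < n → T i * T (i + 1) * T i = T (i + 1) * T i * T (i + 1))
    (hc : ∀ i j, 1 ≤ i → j < n → i + 1 < j → T i * T j = T j * T i) :
    ∀ (m : ℕ) (l : List ℕ), l.length = m → ∀ (l' : List ℕ) (w : Equiv.Perm (Fin n)),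
      Red l w → Red l' w → l'.length = m ∧ rval T l' = rval T l := by
  intro m
  induction m with
  | zero =>
    intro l hl l' w h h'
    obtain rfl : l = [] := List.length_eq_zero_iff.mp hl
    obtain rfl : w = 1 := h
    cases l' with
    | nil => simp
    | cons j l' => exact (not_desc_one h'.1 h'.2.1 h'.2.2.1).elim
  | succ m ih =>
    intro l hl l' w h h'
    cases l with
    | nil => simp at hl
    | cons i l =>
    have hlm : l.length = m := by simpa using hl
    clear hl
    cases l' with
    | nil =>
      obtain rfl : w = 1 := h'
      exact (not_desc_one h.1 h.2.1 h.2.2.1).elim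
    | cons j l' =>
    have far : ∀ i j l l', l.length = m ∨ l'.length = m → Red (i :: l) w → Red (j :: l') w → i + 1 < j →
        (l.length = m ∧ l'.length = m) ∧ rval T l' * T j = rval T l * T i := by
      intro i j l l' hl h h' hij
      obtain ⟨h1, h2, h3, h4⟩ := h
      obtain ⟨g1, g2, g3, g4⟩ := h'
      obtain ⟨u, hu⟩ := exists_red (w * sp n i * sp n j)
      have A1 : Red (j :: u) (w * sp n i) := by
        refine ⟨g1, g2, ?_, hu⟩
        simp only [wv_mul_sp _ h1 h2]
        split_ifs <;> omega
      have A2 : Red (i :: u) (w * sp n j) := by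
        refine ⟨h1, h2, ?_, ?_⟩
        · simp only [wv_mul_sp _ g1 g2]
          split_ifs <;> omega
        · rw [← sp_comm w h1 g2 hij]; exact hu
      have F : (l.length = m ∧ l'.length = m) ∧ rval T (j :: u) = rval T l ∧
          rval T l' = rval T (i :: u) := by
        rcases hl with hl | hl
        · obtain ⟨B1, B2⟩ := ih l hl _ _ h4 A1
          obtain ⟨C1, C2⟩ := ih (i :: u) (by simpa using B1) _ _ A2 g4
          exact ⟨⟨hl, C1⟩, B2, C2⟩
        · obtain ⟨C1, C2⟩ := ih l' hl _ _ g4 A2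
          obtain ⟨B1, B2⟩ := ih (j :: u) (by simpa using C1) _ _ A1 h4
          exact ⟨⟨B1, hl⟩, B2.symm, C2.symm⟩
      obtain ⟨F1, B2, C2⟩ := F
      refine ⟨F1, ?_⟩
      rw [C2, ← B2]
      simp only [rval, mul_assoc]
      rw [hc i j h1 g2 hij]
    have near : ∀ i l l', l.length = m ∨ l'.length = m → Red (i :: l) w → Red ((i + 1) :: l') w →
        (l.length = m ∧ l'.length = m) ∧ rval T l' * T (i + 1) = rval T l * T i := by
      intro i l l' hl h h'
      obtain ⟨h1, h2, h3, h4⟩ := h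
      obtain ⟨g1, g2, g3, g4⟩ := h'
      obtain ⟨u, hu⟩ := exists_red (w * sp n i * sp n (i + 1) * sp n i)
      have A1 : Red ((i + 1) :: i :: u) (w * sp n i) := by
        refine ⟨g1, g2, ?_, h1, h2, ?_, hu⟩
        · simp only [wv_mul_sp _ h1 h2]
          rw [Nat.add_sub_cancel] at *
          split_ifs <;> omega
        · simp only [wv_mul_sp _ h1 h2, wv_mul_sp _ g1 g2]
          rw [Nat.add_sub_cancel] at *
          split_ifs <;> omega
      have A2 : Red (i :: (i + 1) :: u) (w * sp n (i + 1)) := by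
        refine ⟨h1, h2, ?_, g1, g2, ?_, ?_⟩
        · simp only [wv_mul_sp _ g1 g2]
          rw [Nat.add_sub_cancel] at *
          split_ifs <;> omega
        · simp only [wv_mul_sp _ h1 h2, wv_mul_sp _ g1 g2]
          rw [Nat.add_sub_cancel] at *
          split_ifs <;> omega
        · rw [← sp_braid w h1 g2]; exact hu
      have F : (l.length = m ∧ l'.length = m) ∧ rval T ((i + 1) :: i :: u) = rval T l ∧
          rval T l' = rval T (i :: (i + 1) :: u) := by
        rcases hl with hl | hl
        · obtain ⟨B1, B2⟩ := ih l hl _ _ h4 A1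
          obtain ⟨C1, C2⟩ := ih (i :: (i + 1) :: u) (by simpa using B1) _ _ A2 g4
          exact ⟨⟨hl, C1⟩, B2, C2⟩
        · obtain ⟨C1, C2⟩ := ih l' hl _ _ g4 A2
          obtain ⟨B1, B2⟩ := ih ((i + 1) :: i :: u) (by simpa using C1) _ _ A1 h4
          exact ⟨⟨B1, hl⟩, B2.symm, C2.symm⟩
      obtain ⟨F1, B2, C2⟩ := F
      refine ⟨F1, ?_⟩
      rw [C2, ← B2]
      have := hb i h1 g2
      simp only [rval, mul_assoc] at this ⊢
      rw [this]
    simp only [List.length_cons, rval, Nat.add_right_cancel_iff]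
    rcases lt_trichotomy i j with hij | hij | hij
    · rcases Nat.lt_or_ge (i + 1) j with h5 | h5
      · have := far i j l l' (Or.inl hlm) h h' h5
        exact ⟨this.1.2, this.2⟩
      · obtain rfl : j = i + 1 := by omega
        have := near i l l' (Or.inl hlm) h h'
        exact ⟨this.1.2, this.2⟩
    · subst hij
      obtain ⟨B1, B2⟩ := ih l hlm _ _ h.2.2.2 h'.2.2.2
      exact ⟨B1, by rw [B2]⟩
    · rcases Nat.lt_or_ge (j + 1) i with h5 | h5
      · have := far j i l' l (Or.inr hlm) h' h h5
        exact ⟨this.1.1, this.2.symm⟩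
      · obtain rfl : i = j + 1 := by omega
        have := near j l' l (Or.inr hlm) h' h
        exact ⟨this.1.1, this.2.symm⟩

lemma not_desc {n i : ℕ} (w : Equiv.Perm (Fin n)) (h1 : 1 ≤ i) (h2 : i < n)
    (h : ¬ wv w (i - 1) < wv w i) : wv w i < wv w (i - 1) := by
  have : wv w (i - 1) ≠ wv w i := by
    intro he
    have := wv_inj w (by omega) h2 he
    omega
  omega

lemma red_cons_of_up {n i : ℕ} {w : Equiv.Perm (Fin n)} {l : List ℕ} (h1 : 1 ≤ i) (h2 : i < n)
    (h : wv w (i - 1) < wv w i) (hl : Red l w) : Red (i :: l) (w * sp n i) := by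
  refine ⟨h1, h2, ?_, ?_⟩
  · simp only [wv_mul_sp _ h1 h2]
    split_ifs <;> omega
  · rw [sp_sq]; exact hl

/-- Product of simple transpositions along a reversed word. -/
lemma rval_eq {A : Type*} [Monoid A] (T : ℕ → A) (l : List ℕ) :
    rval T l = (l.reverse.map T).prod := by
  induction l with
  | nil => simp [rval]
  | cons i l ih => simp [rval, ih]

lemma red_len {n : ℕ} {w : Equiv.Perm (Fin n)} {l l' : List ℕ} (h : Red l w) (h' : Red l' w) :
    l'.length = l.length :=
  (matsumoto (A := Unit) n (fun _ => 1) (fun _ _ _ => rfl) (fun _ _ _ _ _ => rfl) _ l rfl l' w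
    h h').1

lemma red_rval {n : ℕ} {w : Equiv.Perm (Fin n)} {l : List ℕ} (h : Red l w) :
    rval (sp n) l = w ∧ ∀ j ∈ l, 1 ≤ j ∧ j < n := by
  induction l generalizing w with
  | nil => exact ⟨h.symm, by simp⟩
  | cons i l ih =>
    obtain ⟨h1, h2, h3, h4⟩ := h
    obtain ⟨e, f⟩ := ih h4
    refine ⟨?_, ?_⟩
    · rw [rval, e, sp_sq]
    · intro j hj
      rcases List.mem_cons.mp hj with rfl | hj
      · exact ⟨h1, h2⟩
      · exact f j hj

lemma word_red {n : ℕ} (l : List ℕ) (hl : ∀ j ∈ l, 1 ≤ j ∧ j < n) :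
    ∃ l', Red l' (rval (sp n) l) ∧ l'.length ≤ l.length ∧
      (l'.length = l.length → Red l (rval (sp n) l)) := by
  induction l with
  | nil => exact ⟨[], rfl, le_rfl, fun _ => rfl⟩
  | cons i l ih =>
    obtain ⟨l', h1, h2, h3⟩ := ih (fun j hj => hl j (List.mem_cons_of_mem _ hj))
    obtain ⟨i1, i2⟩ := hl i List.mem_cons_self
    by_cases hu : wv (rval (sp n) l) (i - 1) < wv (rval (sp n) l) i
    · refine ⟨i :: l', red_cons_of_up i1 i2 hu h1, by simpa using h2, ?_⟩
      intro he
      exact red_cons_of_up i1 i2 hu (h3 (by simpa using he))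
    · have hd := not_desc _ i1 i2 hu
      obtain ⟨u, hu⟩ := exists_red (rval (sp n) l * sp n i)
      have h5 : Red (i :: u) (rval (sp n) l) := ⟨i1, i2, hd, hu⟩
      have := red_len h1 h5
      simp only [List.length_cons] at this
      exact ⟨u, hu, by simp only [List.length_cons]; omega, by simp only [List.length_cons]; omega⟩

lemma IsRedWord.red {n : ℕ} {w : Equiv.Perm (Fin n)} {l : List ℕ} (h : IsRedWord n w l) :
    Red l.reverse w := by
  obtain ⟨h1, h2, h3⟩ := h
  have e : rval (sp n) l.reverse = w := by rw [rval_eq, List.reverse_reverse, h2]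
  obtain ⟨l', g1, g2, g3⟩ := word_red l.reverse (by simpa using h1)
  rw [e] at g1 g3
  apply g3
  obtain ⟨r1, r2⟩ := red_rval g1
  have := h3 l'.reverse (by simpa using r2) (by rw [← rval_eq, r1])
  simp only [List.length_reverse] at this g2 ⊢
  omega

/-! ### The combinatorial model of the right regular module -/

/-- Partial right multiplication by `s_i`, defined when the length goes up. -/
def rr (n i : ℕ) (w : Equiv.Perm (Fin n)) : Option (Equiv.Perm (Fin n)) :=
  if 1 ≤ i ∧ i < n ∧ wv w (i - 1) < wv w i then some (w * sp n i) else none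

lemma rr_up {n i : ℕ} {w : Equiv.Perm (Fin n)} (h1 : 1 ≤ i) (h2 : i < n)
    (h : wv w (i - 1) < wv w i) : rr n i w = some (w * sp n i) := by
  simp [rr, h1, h2, h]

lemma rr_dn {n i : ℕ} {w : Equiv.Perm (Fin n)}
    (h : ¬ wv w (i - 1) < wv w i) : rr n i w = none := by
  simp [rr, h]

lemma rr_sq {n i : ℕ} (w : Equiv.Perm (Fin n)) : (rr n i w).bind (rr n i) = none := by
  by_cases h : 1 ≤ i ∧ i < n ∧ wv w (i - 1) < wv w i
  · obtain ⟨h1, h2, h3⟩ := h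
    rw [rr_up h1 h2 h3, Option.bind_some, rr_dn]
    simp only [wv_mul_sp _ h1 h2]
    split_ifs <;> omega
  · simp [rr, h]

lemma rr_comm {n i j : ℕ} (w : Equiv.Perm (Fin n)) (hi : 1 ≤ i) (hj : j < n) (hij : i + 1 < j) :
    (rr n i w).bind (rr n j) = (rr n j w).bind (rr n i) := by
  have hi2 : i < n := by omega
  have hj2 : 1 ≤ j := by omega
  have e1 : wv (w * sp n i) (j - 1) = wv w (j - 1) := by
    rw [wv_mul_sp _ hi hi2, if_neg (by omega), if_neg (by omega)]
  have e2 : wv (w * sp n i) j = wv w j := by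
    rw [wv_mul_sp _ hi hi2, if_neg (by omega), if_neg (by omega)]
  have e3 : wv (w * sp n j) (i - 1) = wv w (i - 1) := by
    rw [wv_mul_sp _ hj2 hj, if_neg (by omega), if_neg (by omega)]
  have e4 : wv (w * sp n j) i = wv w i := by
    rw [wv_mul_sp _ hj2 hj, if_neg (by omega), if_neg (by omega)]
  by_cases h1 : wv w (i - 1) < wv w i <;> by_cases h2 : wv w (j - 1) < wv w j <;>
    simp [rr, hi, hi2, hj, hj2, h1, h2, e1, e2, e3, e4, sp_comm w hi hj hij]

lemma rr_braid {n i : ℕ} (w : Equiv.Perm (Fin n)) (hi : 1 ≤ i) (hj : i + 1 < n) :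
    ((rr n i w).bind (rr n (i + 1))).bind (rr n i) =
      ((rr n (i + 1) w).bind (rr n i)).bind (rr n (i + 1)) := by
  have hb := sp_braid w hi hj
  obtain ⟨p, rfl⟩ : ∃ p, i = p + 1 := ⟨i - 1, by omega⟩
  have hi2 : p + 1 < n := by omega
  have hj2 : 1 ≤ p + 1 + 1 := by omega
  have q1 : p + 1 + 1 ≠ p := by omega
  have q2 : p ≠ p + 1 + 1 := by omega
  have A := fun w => wv_mul_sp (n := n) w hi hi2
  have B := fun w => wv_mul_sp (n := n) w hj2 hj
  simp only [Nat.add_sub_cancel] at A B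
  have U := fun w h => rr_up (n := n) (w := w) hi hi2 h
  have V := fun w h => rr_up (n := n) (w := w) hj2 hj h
  have U' := fun w h => rr_dn (n := n) (w := w) (i := p + 1) h
  have V' := fun w h => rr_dn (n := n) (w := w) (i := p + 1 + 1) h
  simp only [Nat.add_sub_cancel] at U V U' V'
  by_cases h1 : wv w p < wv w (p + 1) <;> by_cases h2 : wv w (p + 1) < wv w (p + 1 + 1) <;>
    by_cases h3 : wv w p < wv w (p + 1 + 1) <;> first
    | omega
    | simp [U, V, U', V', A, B, h1, h2, h3, q1, q2, hb]

/-- States of the model. -/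
abbrev St (n : ℕ) := Equiv.Perm (Fin n) ⊕ Equiv.Perm (Fin n) × ℕ × ℕ

/-- Partial right action of the generator `T_i` on states. -/
def ff (n d i : ℕ) : St n → Option (St n)
  | .inl w => if i = n then some (.inr (w, 0, n - 1)) else (rr n i w).map .inl
  | .inr (w, k, m) =>
    if n ≤ m then none
    else if i = n then
      if m + 1 = n then (if k + 2 < d then some (.inr (w, k + 1, m)) else none)
      else if k = 0 then (rr n (n - 1) w).map (fun w => .inr (w, k, m)) else none
    else if i < m then (rr n i w).map (fun w => .inr (w, k, m))
    else if i = m then some (.inr (w, k, m - 1))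
    else if i = m + 1 then none
    else (rr n (i - 1) w).map (fun w => .inr (w, k, m))

section
variable {n d i k m : ℕ} {w : Equiv.Perm (Fin n)}

lemma ff_inl_n : ff n d n (.inl w) = some (.inr (w, 0, n - 1)) := by simp [ff]
lemma ff_inl_lt (h : i < n) : ff n d i (.inl w) = (rr n i w).map .inl := by
  simp [ff, Nat.ne_of_lt h]
lemma ff_big (h : n ≤ m) : ff n d i (.inr (w, k, m)) = none := by simp [ff, h]
lemma ff_n_top (h : m + 1 = n) (h2 : k + 2 < d) :
    ff n d n (.inr (w, k, m)) = some (.inr (w, k + 1, m)) := by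
  have : ¬ n ≤ m := by omega
  simp [ff, this, h, h2]
lemma ff_n_top' (h : m + 1 = n) (h2 : ¬ k + 2 < d) :
    ff n d n (.inr (w, k, m)) = none := by
  have : ¬ n ≤ m := by omega
  simp [ff, this, h, h2]
lemma ff_n_zero (h : m + 1 < n) :
    ff n d n (.inr (w, 0, m)) = (rr n (n - 1) w).map (fun w => .inr (w, 0, m)) := by
  have : ¬ n ≤ m := by omega
  have h' : m + 1 ≠ n := by omega
  simp [ff, this, h']
lemma ff_n_pos (h : m + 1 < n) (h2 : 0 < k) :
    ff n d n (.inr (w, k, m)) = none := by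
  have : ¬ n ≤ m := by omega
  have h' : m + 1 ≠ n := by omega
  have h2' : k ≠ 0 := by omega
  simp [ff, this, h', h2']
lemma ff_lt (h : i < m) (h2 : m < n) :
    ff n d i (.inr (w, k, m)) = (rr n i w).map (fun w => .inr (w, k, m)) := by
  have a1 : ¬ n ≤ m := by omega
  have a2 : ¬ i = n := by omega
  simp [ff, a1, a2, h]
lemma ff_eq (h : i = m) (h2 : m < n) :
    ff n d i (.inr (w, k, m)) = some (.inr (w, k, m - 1)) := by
  have a1 : ¬ n ≤ m := by omega
  have a2 : ¬ i = n := by omega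
  have a3 : ¬ m = n := by omega
  simp [ff, a1, a3, h]
lemma ff_succ (h : i = m + 1) (h2 : i < n) :
    ff n d i (.inr (w, k, m)) = none := by
  have a1 : ¬ n ≤ m := by omega
  have a2 : ¬ m + 1 = n := by omega
  have a3 : ¬ m + 1 < m := by omega
  simp [ff, a1, a2, a3, h]
lemma ff_gt (h : m + 1 < i) (h2 : i < n) :
    ff n d i (.inr (w, k, m)) = (rr n (i - 1) w).map (fun w => .inr (w, k, m)) := by
  have a1 : ¬ n ≤ m := by omega
  have a2 : ¬ i = n := by omega
  have a3 : ¬ i < m := by omega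
  have a4 : ¬ i = m := by omega
  have a5 : ¬ i = m + 1 := by omega
  simp [ff, a1, a2, a3, a4, a5]
end

lemma map_comm2 {α β : Type*} {x : Option α} {f : α → Option α} {g : α → β}  :
    (x.bind fun a => (f a).map g) = (x.bind f).map g := by
  cases x <;> rfl

lemma ff_sq {n d i : ℕ} (hi : 1 ≤ i) (hn : i < n) (s : St n) :
    (ff n d i s).bind (ff n d i) = none := by
  rcases s with w | ⟨w, k, m⟩
  · simp only [ff_inl_lt hn, Option.bind_map, Function.comp_def, map_comm2, rr_sq, Option.map_none]
  · by_cases h0 : n ≤ m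
    · simp [ff_big h0]
    rcases lt_trichotomy i m with h | h | h
    · simp only [ff_lt h (by omega : m < n), Option.bind_map, Function.comp_def, map_comm2, rr_sq,
        Option.map_none]
    · rw [ff_eq h (by omega), Option.bind_some, ff_succ (by omega) hn]
    · by_cases h2 : i = m + 1
      · rw [ff_succ h2 hn]; rfl
      · simp only [ff_gt (by omega : m + 1 < i) hn, Option.bind_map, Function.comp_def, map_comm2,
          rr_sq, Option.map_none]

lemma ff_comm {n d i j : ℕ} (hi : 1 ≤ i) (hn : j ≤ n) (hij : i + 1 < j) (s : St n) :
    (ff n d i s).bind (ff n d j) = (ff n d j s).bind (ff n d i) := by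
  have hin : i < n := by omega
  rcases hn.eq_or_lt with rfl | hn
  · -- `j = n`
    rcases s with w | ⟨w, k, m⟩
    · simp (disch := omega) only [ff_inl_n, ff_inl_lt, Option.bind_map, Function.comp_def, ff_lt,
        Option.bind_some]
      cases rr j i w <;> rfl
    · by_cases h0 : j ≤ m
      · simp [ff_big h0]
      by_cases h1 : m + 1 = j
      · by_cases h2 : k + 2 < d
        · simp (disch := omega) only [ff_n_top, ff_lt, Option.bind_map, Function.comp_def,
            Option.bind_some]
          cases rr j i w <;> rfl
        · simp (disch := omega) only [ff_n_top', ff_lt, Option.bind_map, Function.comp_def,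
            Option.bind_none]
          cases rr j i w <;> rfl
      by_cases h2 : k = 0
      · subst h2
        rcases lt_trichotomy i m with h | h | h
        · simp (disch := omega) only [ff_n_zero, ff_lt, Option.bind_map, Function.comp_def, map_comm2]
          rw [rr_comm w hi (by omega) (by omega)]
        · simp (disch := omega) only [ff_n_zero, ff_eq, Option.bind_map, Function.comp_def,
            Option.bind_some]
          cases rr j (j - 1) w <;> rfl
        · by_cases h2 : i = m + 1
          · simp (disch := omega) only [ff_n_zero, ff_succ, Option.bind_map, Function.comp_def,
              Option.bind_none]
            cases rr j (j - 1) w <;> rfl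
          · simp (disch := omega) only [ff_n_zero, ff_gt, Option.bind_map, Function.comp_def,
              map_comm2]
            rw [rr_comm w (by omega) (by omega) (by omega)]
      · rw [ff_n_pos (by omega) (by omega), Option.bind_none]
        rcases lt_trichotomy i m with h | h | h
        · simp (disch := omega) only [ff_n_pos, ff_lt, Option.bind_map, Function.comp_def]
          cases rr j i w <;> rfl
        · simp (disch := omega) only [ff_n_pos, ff_eq, Option.bind_some]
        · by_cases h2 : i = m + 1
          · simp (disch := omega) only [ff_succ, Option.bind_none]
          · simp (disch := omega) only [ff_n_pos, ff_gt, Option.bind_map, Function.comp_def]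
            cases rr j (i - 1) w <;> rfl
  · rcases s with w | ⟨w, k, m⟩
    · simp (disch := omega) only [ff_inl_lt, Option.bind_map, Function.comp_def, map_comm2]
      rw [rr_comm w hi (by omega) (by omega)]
    · by_cases h0 : n ≤ m
      · simp [ff_big h0]
      rcases lt_trichotomy j m with h | h | h
      · simp (disch := omega) only [ff_lt, Option.bind_map, Function.comp_def, map_comm2]
        rw [rr_comm w hi (by omega) (by omega)]
      · simp (disch := omega) only [ff_lt, ff_eq, Option.bind_map, Function.comp_def,
          Option.bind_some]
        cases rr n i w <;> rfl
      · by_cases h2 : j = m + 1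
        · simp (disch := omega) only [ff_lt, ff_succ, Option.bind_map, Function.comp_def,
            Option.bind_none]
          cases rr n i w <;> rfl
        rcases lt_trichotomy i m with h | h | h
        · simp (disch := omega) only [ff_lt, ff_gt, Option.bind_map, Function.comp_def, map_comm2]
          rw [rr_comm w hi (by omega) (by omega)]
        · simp (disch := omega) only [ff_eq, ff_gt, Option.bind_map, Function.comp_def,
            Option.bind_some]
          cases rr n (j - 1) w <;> rfl
        · by_cases h3 : i = m + 1
          · simp (disch := omega) only [ff_succ, ff_gt, Option.bind_map, Function.comp_def,
              Option.bind_none]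
            cases rr n (j - 1) w <;> rfl
          · simp (disch := omega) only [ff_gt, Option.bind_map, Function.comp_def, map_comm2]
            rw [rr_comm w (by omega) (by omega) (by omega)]

lemma ff_braid {n d i : ℕ} (hi : 1 ≤ i) (hn : i + 1 ≤ n) (s : St n) :
    ((ff n d i s).bind (ff n d (i + 1))).bind (ff n d i) =
      ((ff n d (i + 1) s).bind (ff n d i)).bind (ff n d (i + 1)) := by
  have hin : i < n := by omega
  rcases hn.eq_or_lt with rfl | hn
  · -- `i + 1 = n`
    rcases s with w | ⟨w, k, m⟩
    · simp (disch := omega) only [ff_inl_n, ff_inl_lt, Option.bind_map, Function.comp_def, ff_eq,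
        Option.bind_some, Nat.add_sub_cancel, ff_n_zero]
      cases rr (i + 1) i w with
      | none => rfl
      | some v => simp (disch := omega) [ff_eq]
    · by_cases h0 : i + 1 ≤ m
      · simp [ff_big h0]
      by_cases h1 : m = i
      · subst h1
        rw [ff_eq rfl (by omega), Option.bind_some]
        have R : ((ff (m + 1) d (m + 1) (.inr (w, k, m))).bind (ff (m + 1) d m)).bind
            (ff (m + 1) d (m + 1)) = none := by
          by_cases h2 : k + 2 < d
          · simp (disch := omega) only [ff_n_top, ff_eq, ff_n_pos, Option.bind_some]
          · simp (disch := omega) only [ff_n_top', Option.bind_none]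
        rw [R]
        by_cases h2 : k = 0
        · subst h2
          simp (disch := omega) only [ff_n_zero, ff_succ, Option.bind_map, Function.comp_def]
          cases rr (m + 1) (m + 1 - 1) w <;> rfl
        · simp (disch := omega) only [ff_n_pos, Option.bind_none]
      by_cases h2 : k = 0
      · subst h2
        by_cases h3 : i = m + 1
        · simp (disch := omega) only [ff_n_zero, ff_succ, Option.bind_map, Function.comp_def,
            Option.bind_none]
          cases rr (i + 1) (i + 1 - 1) w <;> rfl
        · obtain ⟨p, rfl⟩ : ∃ p, i = p + 1 := ⟨i - 1, by omega⟩
          simp (disch := omega) only [ff_n_zero, ff_gt, Option.bind_map, Function.comp_def,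
            map_comm2, Nat.add_sub_cancel, Option.bind_assoc]
          have := rr_braid w (by omega : 1 ≤ p) (by omega : p + 1 < p + 1 + 1)
          simp only [Option.bind_assoc] at this
          rw [this]
      · rw [ff_n_pos (by omega) (by omega), Option.bind_none, Option.bind_none]
        by_cases h3 : i = m + 1
        · simp (disch := omega) only [ff_succ, Option.bind_none]
        · simp (disch := omega) only [ff_gt, ff_n_pos, Option.bind_map, Function.comp_def]
          cases rr (i + 1) (i - 1) w <;> rfl
  · rcases s with w | ⟨w, k, m⟩
    · simp (disch := omega) only [ff_inl_lt, Option.bind_map, Function.comp_def, map_comm2]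
      rw [rr_braid w hi (by omega)]
    · by_cases h0 : n ≤ m
      · simp [ff_big h0]
      by_cases h1 : i + 1 < m
      · simp (disch := omega) only [ff_lt, Option.bind_map, Function.comp_def, map_comm2]
        rw [rr_braid w hi (by omega)]
      by_cases h2 : m = i + 1
      · subst h2
        simp (disch := omega) only [ff_lt, ff_eq, Option.bind_map, Function.comp_def,
            Option.bind_some, Nat.add_sub_cancel, ff_gt]
        cases rr n i w with
        | none => rfl
        | some v => simp (disch := omega) [ff_eq]
      by_cases h3 : m = i
      · subst h3
        simp (disch := omega) only [ff_eq, ff_succ, ff_gt, Option.bind_map, Function.comp_def,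
            Option.bind_some, Option.bind_none, Nat.add_sub_cancel]
        cases rr n m w <;> rfl
      by_cases h4 : i = m + 1
      · subst h4
        simp (disch := omega) only [ff_succ, ff_gt, Option.bind_map, Function.comp_def,
            Option.bind_none]
        cases rr n (m + 1 + 1 - 1) w <;> rfl
      · obtain ⟨p, rfl⟩ : ∃ p, i = p + 1 := ⟨i - 1, by omega⟩
        simp (disch := omega) only [ff_gt, Option.bind_map, Function.comp_def, map_comm2,
          Nat.add_sub_cancel]
        rw [rr_braid w (by omega) (by omega)]

/-! ### The linear model -/

section
variable (k : Type) [CommRing k]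

/-- The vector attached to a state (or zero). -/
noncomputable def ov {S : Type} (x : Option S) : S →₀ k :=
  x.elim 0 (fun s => Finsupp.single s 1)

/-- The linear operator attached to a partial function. -/
noncomputable def opf {S : Type} (f : S → Option S) : (S →₀ k) →ₗ[k] (S →₀ k) :=
  Finsupp.linearCombination k (fun s => ov k (f s))

lemma opf_ov {S : Type} (f : S → Option S) (x : Option S) :
    opf k f (ov k x) = ov k (x.bind f) := by
  cases x <;> simp [opf, ov]

lemma opf_single {S : Type} (f : S → Option S) (s : S) :
    opf k f (Finsupp.single s 1) = ov k (f s) := by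
  simp [opf]

lemma ov_some {S : Type} (s : S) : ov k (some s) = Finsupp.single s 1 := rfl
lemma ov_none {S : Type} : ov k (none : Option S) = 0 := rfl

lemma opf_pow_top {n d : ℕ} (w : Equiv.Perm (Fin n)) (j a m : ℕ) (hm : m + 1 = n)
    (h : d ≤ a + 1 + j + 1) :
    (opf k (ff n d n) ^ (j + 1)) (ov k (some (.inr (w, a, m)))) = 0 := by
  induction j generalizing a with
  | zero =>
    rw [zero_add, pow_one, opf_ov, Option.bind_some, ff_n_top' hm (by omega), ov_none]
  | succ j ih =>
    rw [pow_succ, Module.End.mul_apply, opf_ov, Option.bind_some]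
    by_cases h2 : a + 2 < d
    · rw [ff_n_top hm h2]
      exact ih (a + 1) (by omega)
    · rw [ff_n_top' hm h2, ov_none, map_zero]

lemma opf_pow_last {n d : ℕ} (hn : 1 ≤ n) (hd : 2 ≤ d) : opf k (ff n d n) ^ d = 0 := by
  obtain ⟨e, rfl⟩ : ∃ e, d = e + 2 := ⟨d - 2, by omega⟩
  apply Finsupp.lhom_ext'
  intro s
  apply LinearMap.ext_ring
  change (opf k (ff n (e + 2) n) ^ (e + 2)) (ov k (some s)) = 0
  rcases s with w | ⟨w, a, m⟩
  · rw [pow_succ, Module.End.mul_apply, opf_ov, Option.bind_some, ff_inl_n]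
    exact opf_pow_top k w e 0 (n - 1) (by omega) (by omega)
  · by_cases h0 : n ≤ m
    · rw [pow_succ, Module.End.mul_apply, opf_ov, Option.bind_some, ff_big h0, ov_none, map_zero]
    by_cases h1 : m + 1 = n
    · exact opf_pow_top k w (e + 1) a m h1 (by omega)
    · rw [pow_add, Module.End.mul_apply, pow_two, Module.End.mul_apply, opf_ov, opf_ov]
      have : ((some (.inr (w, a, m) : St n)).bind (ff n (e + 2) n)).bind (ff n (e + 2) n) = none := by
        rw [Option.bind_some]
        by_cases h2 : a = 0
        · subst h2
          simp (disch := omega) only [ff_n_zero, Option.bind_map, Function.comp_def, map_comm2,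
            rr_sq, Option.map_none]
        · simp (disch := omega) only [ff_n_pos, Option.bind_none]
      rw [this, ov_none, map_zero]

/-- The right action of `NC_A(n,d)` on the model. -/
noncomputable def actHom (n d : ℕ) (hd : 2 ≤ d) :
    NCA k n d →ₐ[k] (Module.End k (St n →₀ k))ᵐᵒᵖ :=
  RingQuot.liftAlgHom k ⟨FreeAlgebra.lift k
    (fun i : Fin n => MulOpposite.op (opf k (ff n d ((i : ℕ) + 1)))), by
    intro x y h
    have sext : ∀ f g : Module.End k (St n →₀ k),
        (∀ s, f (ov k (some s)) = g (ov k (some s))) → f = g := by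
      intro f g hfg
      apply Finsupp.lhom_ext'
      intro s
      apply LinearMap.ext_ring
      exact hfg s
    induction h with
    | braid i j h =>
      simp only [map_mul, FreeAlgebra.lift_ι_apply]
      rw [← MulOpposite.op_mul, ← MulOpposite.op_mul, ← MulOpposite.op_mul, ← MulOpposite.op_mul]
      congr 1
      apply sext
      intro s
      simp only [Module.End.mul_apply, opf_ov, Option.bind_some]
      rw [← h, ff_braid (by omega) (by omega)]
    | comm i j h =>
      simp only [map_mul, FreeAlgebra.lift_ι_apply]
      rw [← MulOpposite.op_mul, ← MulOpposite.op_mul]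
      congr 1
      apply sext
      intro s
      simp only [Module.End.mul_apply, opf_ov, Option.bind_some]
      rw [ff_comm (by omega) (by omega) (by omega)]
    | sq i h =>
      simp only [map_pow, FreeAlgebra.lift_ι_apply, map_zero]
      rw [← MulOpposite.op_pow, ← MulOpposite.op_zero]
      congr 1
      apply sext
      intro s
      simp only [pow_two, Module.End.mul_apply, opf_ov, Option.bind_some]
      rw [ff_sq (by omega) (by omega)]
      rfl
    | last i h =>
      simp only [map_pow, FreeAlgebra.lift_ι_apply, map_zero]
      rw [← MulOpposite.op_pow, ← MulOpposite.op_zero, h, opf_pow_last k (by omega) hd]⟩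

lemma actHom_Tg (n d : ℕ) (hd : 2 ≤ d) {j : ℕ} (h1 : 1 ≤ j) (h2 : j ≤ n) :
    actHom k n d hd (Tg k n d j) = MulOpposite.op (opf k (ff n d j)) := by
  have : j - 1 + 1 = j := by omega
  rw [Tg, dif_pos ⟨h1, h2⟩, actHom, RingQuot.liftAlgHom_mkAlgHom_apply, FreeAlgebra.lift_ι_apply]
  simp only [this]

/-- The orbit map of the initial state. -/
noncomputable def orb (n d : ℕ) (hd : 2 ≤ d) : NCA k n d →ₗ[k] (St n →₀ k) where
  toFun a := (actHom k n d hd a).unop (ov k (some (.inl 1)))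
  map_add' := by intros; simp
  map_smul' := by intros; simp

variable {n d : ℕ}

lemma orb_mul_Tg (hd : 2 ≤ d) (a : NCA k n d) {j : ℕ} (h1 : 1 ≤ j) (h2 : j ≤ n) :
    orb k n d hd (a * Tg k n d j) = opf k (ff n d j) (orb k n d hd a) := by
  simp [orb, actHom_Tg k n d hd h1 h2]

lemma orb_red (hd : 2 ≤ d) (l : List ℕ) (w : Equiv.Perm (Fin n)) (h : Red l w) :
    orb k n d hd (rval (Tg k n d) l) = ov k (some (.inl w)) := by
  induction l generalizing w with
  | nil =>
    obtain rfl : w = 1 := h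
    simp [rval, orb]
  | cons i l ih =>
    obtain ⟨h1, h2, h3, h4⟩ := h
    rw [rval, orb_mul_Tg k hd _ h1 h2.le, ih _ h4, opf_ov, Option.bind_some, ff_inl_lt h2,
      rr_up h1 h2, sp_sq]
    · rfl
    · simp only [wv_mul_sp _ h1 h2]
      split_ifs <;> omega

lemma descT_top : descT k n d n = 1 := by simp [descT]

lemma descT_step {m : ℕ} (h : m < n) :
    descT k n d m = descT k n d (m + 1) * Tg k n d m := by
  have : n - m = (n - (m + 1)) + 1 := by omega
  rw [descT, this, List.range'_succ]
  simp [descT]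

lemma orb_pow (hd : 2 ≤ d) (hn : 1 ≤ n) (a : NCA k n d) (w : Equiv.Perm (Fin n))
    (ha : orb k n d hd a = ov k (some (.inl w))) (j : ℕ) (hj : j + 1 < d) :
    orb k n d hd (a * Tg k n d n ^ (j + 1)) = ov k (some (.inr (w, j, n - 1))) := by
  induction j with
  | zero =>
    rw [zero_add, pow_one, orb_mul_Tg k hd _ hn le_rfl, ha, opf_ov, Option.bind_some, ff_inl_n]
  | succ j ih =>
    rw [pow_succ, ← mul_assoc, orb_mul_Tg k hd _ hn le_rfl, ih (by omega), opf_ov,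
      Option.bind_some, ff_n_top (by omega) (by omega)]

lemma orb_desc (hd : 2 ≤ d) (a : NCA k n d) (w : Equiv.Perm (Fin n)) (j : ℕ)
    (ha : orb k n d hd a = ov k (some (.inr (w, j, n - 1)))) (m : ℕ) (hm : m < n) :
    orb k n d hd (a * descT k n d (m + 1)) = ov k (some (.inr (w, j, m))) := by
  obtain ⟨e, he⟩ : ∃ e, n - 1 - m = e := ⟨_, rfl⟩
  induction e generalizing m with
  | zero =>
    obtain rfl : n = m + 1 := by omega
    rw [descT_top, mul_one, ha]; rfl
  | succ e ih =>
    rw [descT_step k (by omega), ← mul_assoc, orb_mul_Tg k hd _ (by omega) (by omega),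
      ih (m + 1) (by omega) (by omega), opf_ov, Option.bind_some, ff_eq rfl (by omega)]
    rfl

lemma TwOf_eq (l : List ℕ) : TwOf k n d l = rval (Tg k n d) l.reverse := by
  rw [rval_eq, List.reverse_reverse]; rfl

lemma ncaFam_linInd (hd : 2 ≤ d) (hn : 1 ≤ n) (rw' : Equiv.Perm (Fin n) → List ℕ)
    (hrw : ∀ w, IsRedWord n w (rw' w)) : LinearIndependent k (ncaFam k n d rw') := by
  apply LinearIndependent.of_comp (orb k n d hd)
  let emb : Equiv.Perm (Fin n) ⊕ Equiv.Perm (Fin n) × Fin (d - 1) × Fin n → St n :=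
    Sum.map id (fun x => (x.1, (x.2.1 : ℕ), (x.2.2 : ℕ)))
  have hemb : Function.Injective emb := by
    rintro (a | ⟨a, b, c⟩) (a' | ⟨a', b', c'⟩) h
    · simpa [emb] using h
    · simp [emb] at h
    · simp [emb] at h
    · simp only [emb, Sum.map_inr, Sum.inr.injEq, Prod.mk.injEq] at h
      obtain ⟨rfl, h2, h3⟩ := h
      rw [Fin.ext h2, Fin.ext h3]
  have key : (orb k n d hd) ∘ ncaFam k n d rw' =
      (fun s : St n => (Finsupp.single s 1 : St n →₀ k)) ∘ emb := by
    funext s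
    rcases s with w | ⟨w, a, m⟩
    · simp only [Function.comp, ncaFam, TwOf_eq]
      rw [orb_red k hd _ w (hrw w).red]
      rfl
    · simp only [Function.comp, ncaFam, TwOf_eq]
      rw [orb_desc k hd _ w a _ m m.2]
      · rfl
      · exact orb_pow k hd hn _ w (orb_red k hd _ w (hrw w).red) _ (by omega)
  rw [key]
  exact (Finsupp.linearIndependent_single_one k (St n)).comp emb hemb

/-! ### Spanning -/

lemma Tg_braid {i : ℕ} (h1 : 1 ≤ i) (h2 : i + 1 ≤ n) :
    Tg k n d i * Tg k n d (i + 1) * Tg k n d i =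
      Tg k n d (i + 1) * Tg k n d i * Tg k n d (i + 1) := by
  rw [Tg, dif_pos ⟨h1, by omega⟩, Tg, dif_pos ⟨by omega, h2⟩]
  simp only [← map_mul]
  exact RingQuot.mkAlgHom_rel k (NCRel.braid _ _ (by simp; omega))

lemma Tg_comm {i j : ℕ} (h1 : 1 ≤ i) (h2 : j ≤ n) (h : i + 1 < j) :
    Tg k n d i * Tg k n d j = Tg k n d j * Tg k n d i := by
  rw [Tg, dif_pos ⟨h1, by omega⟩, Tg, dif_pos ⟨by omega, h2⟩]
  simp only [← map_mul]
  exact RingQuot.mkAlgHom_rel k (NCRel.comm _ _ (by simp; omega))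

lemma Tg_sq {i : ℕ} (h1 : 1 ≤ i) (h2 : i < n) : Tg k n d i * Tg k n d i = 0 := by
  rw [Tg, dif_pos ⟨h1, by omega⟩, ← map_mul, ← pow_two]
  rw [RingQuot.mkAlgHom_rel k (NCRel.sq _ (by simp; omega)), map_zero]

lemma Tg_last (h1 : 1 ≤ n) : Tg k n d n ^ d = 0 := by
  rw [Tg, dif_pos ⟨h1, le_rfl⟩, ← map_pow]
  rw [RingQuot.mkAlgHom_rel k (NCRel.last _ (by simp; omega)), map_zero]

/-- downward induction helper -/
lemma down_ind (P : ℕ → Prop) (top : ℕ) (h0 : P top) (hs : ∀ m < top, P (m + 1) → P m) :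
    ∀ m ≤ top, P m := by
  intro m hm
  obtain ⟨e, he⟩ : ∃ e, top - m = e := ⟨_, rfl⟩
  induction e generalizing m with
  | zero =>
    obtain rfl : m = top := by omega
    exact h0
  | succ e ih => exact hs m (by omega) (ih (m + 1) (by omega) (by omega))

lemma desc_low {i m : ℕ} (hi : 1 ≤ i) (him : i + 1 < m) (hm : m ≤ n) :
    descT k n d m * Tg k n d i = Tg k n d i * descT k n d m := by
  revert him
  refine down_ind (fun m => i + 1 < m → descT k n d m * Tg k n d i = Tg k n d i * descT k n d m)
    n ?_ ?_ m hm
  · intro _; rw [descT_top, mul_one, one_mul]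
  · intro m hm ih h
    rw [descT_step k hm, mul_assoc, ← Tg_comm k hi hm.le h, ← mul_assoc, ih (by omega), mul_assoc]

lemma desc_sq {m : ℕ} (hi : 1 ≤ m) (hm : m < n) :
    descT k n d m * Tg k n d m = 0 := by
  rw [descT_step k hm, mul_assoc, Tg_sq k hi hm, mul_zero]

lemma desc_high {i m : ℕ} (hm1 : 1 ≤ m) (him : m < i) (hi : i < n) :
    descT k n d m * Tg k n d i = Tg k n d (i - 1) * descT k n d m := by
  obtain ⟨p, rfl⟩ : ∃ p, i = p + 1 := ⟨i - 1, by omega⟩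
  rw [Nat.add_sub_cancel]
  revert hm1
  refine down_ind (fun m => 1 ≤ m → descT k n d m * Tg k n d (p + 1) =
    Tg k n d p * descT k n d m) p ?_ ?_ m (by omega)
  · intro h
    rw [descT_step k (by omega : p < n), descT_step k hi, mul_assoc, mul_assoc, ← mul_assoc (Tg _ _ _ (p + 1)),
      ← Tg_braid k h (by omega), ← mul_assoc, ← mul_assoc, desc_low k h (by omega) (by omega)]
    simp only [mul_assoc]
  · intro m hm ih h
    rw [descT_step k (by omega : m < n), mul_assoc, Tg_comm k h (by omega) (by omega), ← mul_assoc,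
      ih (by omega), mul_assoc]

lemma desc_n {m : ℕ} (hm1 : 1 ≤ m) (hm : m < n) :
    Tg k n d n * descT k n d m * Tg k n d n = Tg k n d (n - 1) * (Tg k n d n * descT k n d m) := by
  obtain ⟨p, rfl⟩ : ∃ p, n = p + 1 := ⟨n - 1, by omega⟩
  rw [Nat.add_sub_cancel]
  revert hm1
  refine down_ind (fun m => 1 ≤ m → Tg k (p + 1) d (p + 1) * descT k (p + 1) d m *
    Tg k (p + 1) d (p + 1) = Tg k (p + 1) d p *
      (Tg k (p + 1) d (p + 1) * descT k (p + 1) d m)) p ?_ ?_ m (by omega)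
  · intro h
    rw [descT_step k (by omega), descT_top, one_mul, ← Tg_braid k h (by omega), mul_assoc]
  · intro m hm ih h
    rw [descT_step k (by omega), mul_assoc, mul_assoc, Tg_comm k h (by omega) (by omega),
      ← mul_assoc, ← mul_assoc, ih (by omega)]
    simp only [mul_assoc]

lemma desc_left {m : ℕ} (hm1 : 1 ≤ m) (hm : m < n) :
    Tg k n d (n - 1) * descT k n d m = 0 := by
  obtain ⟨p, rfl⟩ : ∃ p, n = p + 1 := ⟨n - 1, by omega⟩
  rw [Nat.add_sub_cancel]
  revert hm1
  refine down_ind (fun m => 1 ≤ m → Tg k (p + 1) d p * descT k (p + 1) d m = 0)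
     p ?_ ?_ m (by omega)
  · intro h
    rw [descT_step k (by omega), descT_top, one_mul, Tg_sq k h (by omega)]
  · intro m hm ih h
    rw [descT_step k (by omega), ← mul_assoc, ih (by omega), zero_mul]

lemma pow_desc_n {m a : ℕ} (hm1 : 1 ≤ m) (hm : m < n) :
    Tg k n d n ^ (a + 2) * descT k n d m * Tg k n d n = 0 := by
  have h := desc_n k (d := d) hm1 hm
  have hb := Tg_braid k (n := n) (d := d) (i := n - 1) (by omega) (by omega)
  have e : n - 1 + 1 = n := by omega
  rw [e] at hb
  calc Tg k n d n ^ (a + 2) * descT k n d m * Tg k n d n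
      = Tg k n d n ^ a * (Tg k n d n * (Tg k n d n * descT k n d m * Tg k n d n)) := by
        rw [pow_add, pow_two]; simp only [mul_assoc]
    _ = Tg k n d n ^ a * ((Tg k n d n * Tg k n d (n - 1) * Tg k n d n) * descT k n d m) := by
        rw [h]; simp only [mul_assoc]
    _ = Tg k n d n ^ a * ((Tg k n d (n - 1) * Tg k n d n) *
          (Tg k n d (n - 1) * descT k n d m)) := by
        rw [← hb]; simp only [mul_assoc]
    _ = 0 := by rw [desc_left k hm1 hm, mul_zero, mul_zero]

lemma pow_comm_n {i a : ℕ} (hi : 1 ≤ i) (h : i + 1 < n) :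
    Tg k n d n ^ a * Tg k n d i = Tg k n d i * Tg k n d n ^ a :=
  ((show Commute (Tg k n d i) (Tg k n d n) from Tg_comm k hi le_rfl h).pow_right a).eq.symm

lemma TwOf_mul (rw' : Equiv.Perm (Fin n) → List ℕ) (hrw : ∀ w, IsRedWord n w (rw' w))
    (w : Equiv.Perm (Fin n)) {i : ℕ} (h1 : 1 ≤ i) (h2 : i < n) :
    TwOf k n d (rw' w) * Tg k n d i = TwOf k n d (rw' (w * sp n i)) ∨
      TwOf k n d (rw' w) * Tg k n d i = 0 := by
  have M := matsumoto n (Tg k n d) (fun i h1 h2 => Tg_braid k h1 h2.le)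
    (fun i j h1 h2 h => Tg_comm k h1 h2.le h)
  by_cases hu : wv w (i - 1) < wv w i
  · left
    rw [TwOf_eq, TwOf_eq]
    exact (M _ _ rfl (i :: (rw' w).reverse) _ (hrw (w * sp n i)).red
      (red_cons_of_up h1 h2 hu (hrw w).red)).2
  · right
    have h3 : Red (i :: (rw' (w * sp n i)).reverse) w :=
      ⟨h1, h2, not_desc w h1 h2 hu, (hrw _).red⟩
    have := (M _ _ rfl _ _ h3 (hrw w).red).2
    rw [TwOf_eq, this, rval, mul_assoc, Tg_sq k h1 h2, mul_zero]

lemma ncaFam_span (rw' : Equiv.Perm (Fin n) → List ℕ) (hrw : ∀ w, IsRedWord n w (rw' w))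
    (hn : 1 ≤ n) : Submodule.span k (Set.range (ncaFam k n d rw')) = ⊤ := by
  set V := Submodule.span k (Set.range (ncaFam k n d rw')) with hV
  have hl : ∀ w, TwOf k n d (rw' w) ∈ V := fun w => Submodule.subset_span ⟨.inl w, rfl⟩
  have hr : ∀ w a m, m < n →
      TwOf k n d (rw' w) * Tg k n d n ^ (a + 1) * descT k n d (m + 1) ∈ V := by
    intro w a m hm
    by_cases ha : a < d - 1
    · exact Submodule.subset_span ⟨.inr (w, ⟨a, ha⟩, ⟨m, hm⟩), rfl⟩
    · obtain ⟨c, hc⟩ : ∃ c, a + 1 = d + c := ⟨a + 1 - d, by omega⟩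
      rw [hc, pow_add, Tg_last k hn]
      simp
  have hr' : ∀ w a m i, m < n → 1 ≤ i → i < n → TwOf k n d (rw' w) * Tg k n d i *
      Tg k n d n ^ (a + 1) * descT k n d (m + 1) ∈ V := by
    intro w a m i hm h1 h2
    rcases TwOf_mul k rw' hrw w h1 h2 (d := d) with h | h
    · rw [h]; exact hr _ _ _ hm
    · rw [h]; simp
  have hT : ∀ j, 1 ≤ j → j ≤ n → ∀ v ∈ V, v * Tg k n d j ∈ V := by
    intro j h1 h2 v hv
    induction hv using Submodule.span_induction with
    | zero => simp
    | add x y _ _ hx hy => rw [add_mul]; exact V.add_mem hx hy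
    | smul c x _ hx => rw [smul_mul_assoc]; exact V.smul_mem c hx
    | mem x hx =>
      obtain ⟨s, rfl⟩ := hx
      rcases s with w | ⟨w, a, m⟩
      · simp only [ncaFam]
        rcases h2.eq_or_lt with rfl | h2
        · have := hr w 0 (j - 1) (by omega)
          have e : j - 1 + 1 = j := by omega
          rwa [e, descT_top, mul_one, zero_add, pow_one] at this
        · rcases TwOf_mul k rw' hrw w h1 h2 (d := d) with h | h
          · rw [h]; exact hl _
          · rw [h]; simp
      · simp only [ncaFam]
        have hm := m.2
        rcases h2.eq_or_lt with rfl | h2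
        · by_cases h3 : (m : ℕ) + 1 = j
          · have := hr w (a + 1) m hm
            rw [h3, descT_top, mul_one] at this ⊢
            rwa [mul_assoc, ← pow_succ]
          · obtain ha | ⟨b, hb⟩ : (a : ℕ) = 0 ∨ ∃ b, (a : ℕ) = b + 1 := by
              rcases (a : ℕ) with _ | b
              · exact Or.inl rfl
              · exact Or.inr ⟨b, rfl⟩
            · have := hr' w 0 m (j - 1) hm (by omega) (by omega)
              rw [ha]
              rw [zero_add, pow_one] at this ⊢
              have h := desc_n k (d := d) (n := j) (m := m + 1) (by omega) (by omega)
              rw [mul_assoc, mul_assoc, ← mul_assoc (Tg k j d j), h]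
              simpa only [mul_assoc] using this
            · rw [hb, mul_assoc, mul_assoc, ← mul_assoc (Tg k j d j ^ _),
                pow_desc_n k (by omega) (by omega), mul_zero]
              exact V.zero_mem
        · rcases lt_trichotomy j m with h | h | h
          · have := hr' w a m j hm h1 h2
            rw [mul_assoc, desc_low k h1 (by omega) (by omega), ← mul_assoc,
              mul_assoc (TwOf _ _ _ _), pow_comm_n k h1 (by omega), ← mul_assoc]
            exact this
          · have := hr w a (m - 1) (by omega)
            have e : (m : ℕ) - 1 + 1 = m := by omega
            rw [e, descT_step k hm, ← mul_assoc, ← h] at this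
            rw [← h]; exact this
          · by_cases h3 : j = m + 1
            · rw [mul_assoc, h3, desc_sq k (by omega) (by omega), mul_zero]
              exact V.zero_mem
            · have := hr' w a m (j - 1) hm (by omega) (by omega)
              rw [mul_assoc, desc_high k (by omega) (by omega) h2, ← mul_assoc,
                mul_assoc (TwOf _ _ _ _), pow_comm_n k (by omega) (by omega), ← mul_assoc]
              exact this
  have h1 : (1 : NCA k n d) ∈ V := by
    have h := hl 1
    have hlen := red_len (w := (1 : Equiv.Perm (Fin n))) (l := []) rfl (hrw 1).red
    have : rw' 1 = [] := by simpa using hlen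
    rw [this] at h
    simpa [TwOf] using h
  have hF : ∀ x : FreeAlgebra k (Fin n), ∀ v ∈ V, v * RingQuot.mkAlgHom k (NCRel k n d) x ∈ V := by
    intro x
    induction x using FreeAlgebra.induction with
    | grade0 r =>
      intro v hv
      rw [AlgHom.commutes, ← Algebra.commutes, ← Algebra.smul_def]
      exact V.smul_mem r hv
    | grade1 i =>
      intro v hv
      have := hT (i + 1) (by omega) (by omega) v hv
      rw [Tg, dif_pos ⟨by omega, by omega⟩] at this
      exact this
    | mul a b ha hb =>
      intro v hv
      rw [map_mul, ← mul_assoc]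
      exact hb _ (ha _ hv)
    | add a b ha hb =>
      intro v hv
      rw [map_add, mul_add]
      exact V.add_mem (ha _ hv) (hb _ hv)
  rw [eq_top_iff]
  intro y _
  obtain ⟨x, rfl⟩ := RingQuot.mkAlgHom_surjective k (NCRel k n d) y
  simpa using hF x 1 h1
end

/-- **Theorem A** (Khare): `NC_A(n,d)` is a free `k`-module of rank `n!(1 + n(d-1))`,
with `k`-basis `{T_w : w ∈ S_n} ⊔ {T_w T_n^k T_{n-1} ⋯ T_m : w ∈ S_n, 1 ≤ k ≤ d-1,
1 ≤ m ≤ n}` (where `T_w` is the product of generators along any reduced word for `w`). -/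
theorem NCA_free_with_basis (k : Type) [CommRing k] (n d : ℕ) (hn : 1 ≤ n) (hd : 2 ≤ d)
    (rw : Equiv.Perm (Fin n) → List ℕ) (hrw : ∀ w, IsRedWord n w (rw w)) :
    LinearIndependent k (ncaFam k n d rw) ∧
      Submodule.span k (Set.range (ncaFam k n d rw)) = ⊤ ∧
      Nat.card (Equiv.Perm (Fin n) ⊕ Equiv.Perm (Fin n) × Fin (d - 1) × Fin n) =
        n.factorial * (1 + n * (d - 1)) := by
  refine ⟨ncaFam_linInd k hd hn rw hrw, ncaFam_span k rw hrw hn, ?_⟩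
  rw [Nat.card_eq_fintype_card]
  simp only [Fintype.card_sum, Fintype.card_prod, Fintype.card_perm, Fintype.card_fin]
  ring
end

section
/- In NC_A(n,d) with n ≥ 2 and d ≥ 3, the k-module of two-sided primitive elements (elements x with T_i x = x T_i = 0 for all i) is free of rank d-1, spanned by the words T_{w'_∘} T_n^k T_{n-1} ⋯ T_1 for 1 ≤ k ≤ d-1, where w'_∘ is the longest element of S_n. -/
/-- A fixed reduced word for the longest element `w'_∘` of `S_n`:
`(1)(21)(321)⋯(n-1 ⋯ 2 1)`. -/
def longestWord (n : ℕ) : List ℕ :=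
  (List.range n).flatMap fun j => (List.range' 1 j).reverse

/-- The candidate primitive elements `T_{w'_∘} T_n^{k_0+1} T_{n-1} ⋯ T_1` of
`NC_A(n,d)`, for `k_0 : Fin (d-1)`. -/
noncomputable def primFam (k : Type) [CommRing k] (n d : ℕ) (k0 : Fin (d - 1)) :
    NCA k n d :=
  TwOf k n d (longestWord n) * Tg k n d n ^ ((k0 : ℕ) + 1) * descT k n d 1

namespace NCP

/-- The relations of `NC_A(n,d)` for a family `t` in a ring. -/
structure NilRel {R : Type} [Ring R] (t : ℕ → R) (n d : ℕ) : Prop where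
  braid : ∀ i, 1 ≤ i → i + 1 ≤ n → t i * t (i+1) * t i = t (i+1) * t i * t (i+1)
  comm : ∀ i j, 1 ≤ i → i + 1 < j → j ≤ n → t i * t j = t j * t i
  sq : ∀ i, 1 ≤ i → i < n → t i * t i = 0
  last : 1 ≤ n → t n ^ d = 0

theorem Tg_rel (k : Type) [CommRing k] (n d : ℕ) : NilRel (Tg k n d) n d := by
  constructor
  · intro i h1 h2
    have := RingQuot.mkAlgHom_rel k (NCRel.braid (k := k) (n := n) (d := d)
      ⟨i-1, by omega⟩ ⟨i+1-1, by omega⟩ (by simp; omega))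
    simp only [map_mul] at this
    simp only [Tg, dif_pos (show 1 ≤ i ∧ i ≤ n by omega),
      dif_pos (show 1 ≤ i+1 ∧ i+1 ≤ n by omega), this]
  · intro i j h1 h2 h3
    have := RingQuot.mkAlgHom_rel k (NCRel.comm (k := k) (n := n) (d := d)
      ⟨i-1, by omega⟩ ⟨j-1, by omega⟩ (by simp; omega))
    simp only [map_mul] at this
    simp only [Tg, dif_pos (show 1 ≤ i ∧ i ≤ n by omega),
      dif_pos (show 1 ≤ j ∧ j ≤ n by omega), this]
  · intro i h1 h2
    have := RingQuot.mkAlgHom_rel k (NCRel.sq (k := k) (n := n) (d := d)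
      ⟨i-1, by omega⟩ (by simp; omega))
    simp only [map_pow, map_zero] at this
    simp only [Tg, dif_pos (show 1 ≤ i ∧ i ≤ n by omega), ← pow_two, this]
  · intro h
    have := RingQuot.mkAlgHom_rel k (NCRel.last (k := k) (n := n) (d := d)
      ⟨n-1, by omega⟩ (by simp; omega))
    simp only [map_pow, map_zero] at this
    simp only [Tg, dif_pos (show 1 ≤ n ∧ n ≤ n by omega), this]

theorem exists_lift {k : Type} [CommRing k] {n d : ℕ} {R : Type} [Ring R] [Algebra k R]
    {t : ℕ → R} (h : NilRel t n d) :
    ∃ φ : NCA k n d →ₐ[k] R, ∀ j, 1 ≤ j → j ≤ n → φ (Tg k n d j) = t j := by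
  have key : ∀ ⦃x y : FreeAlgebra k (Fin n)⦄, NCRel k n d x y →
      FreeAlgebra.lift k (fun i : Fin n => t (i + 1)) x =
      FreeAlgebra.lift k (fun i : Fin n => t (i + 1)) y := by
    intro x y hxy
    cases hxy with
    | braid i j hij =>
      simp only [map_mul, FreeAlgebra.lift_ι_apply, ← hij]
      exact h.braid _ (by omega) (by omega)
    | comm i j hij =>
      simp only [map_mul, FreeAlgebra.lift_ι_apply]
      exact h.comm _ _ (by omega) (by omega) (by omega)
    | sq i hi =>
      rw [map_pow, map_zero, FreeAlgebra.lift_ι_apply, pow_two]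
      exact h.sq _ (by omega) hi
    | last i hi =>
      simp only [map_pow, map_zero, FreeAlgebra.lift_ι_apply, hi]
      exact h.last (by omega)
  refine ⟨RingQuot.liftAlgHom k ⟨_, key⟩, ?_⟩
  intro j h1 h2
  rw [Tg, dif_pos ⟨h1, h2⟩, RingQuot.liftAlgHom_mkAlgHom_apply, FreeAlgebra.lift_ι_apply]
  congr 1
  simp; omega

theorem nca_induction {k : Type} [CommRing k] {n d : ℕ} {P : NCA k n d → Prop}
    (hs : ∀ c : k, P (algebraMap k _ c)) (hg : ∀ j, 1 ≤ j → j ≤ n → P (Tg k n d j))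
    (hm : ∀ x y, P x → P y → P (x * y)) (ha : ∀ x y, P x → P y → P (x + y)) (x : NCA k n d) :
    P x := by
  obtain ⟨y, rfl⟩ := RingQuot.mkAlgHom_surjective k (NCRel k n d) x
  induction y using FreeAlgebra.induction with
  | grade0 r => rw [AlgHom.commutes]; exact hs r
  | grade1 i =>
    have := hg (i+1) (by omega) (by omega)
    rw [Tg, dif_pos (by omega)] at this
    exact this
  | mul a b ha hb => rw [map_mul]; exact hm _ _ ha hb
  | add a b h1 h2 => rw [map_add]; exact ha _ _ h1 h2

/-- the descending product `t_{n-1} ⋯ t_m` -/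
def desc {R : Type} [Ring R] (t : ℕ → R) (m n : ℕ) : R :=
  ((List.range' m (n - m)).reverse.map t).prod

section desc
variable {R : Type} [Ring R] (t : ℕ → R)

theorem desc_self (n : ℕ) : desc t n n = 1 := by simp [desc]

theorem desc_right {m n : ℕ} (h : m < n) : desc t m n = desc t (m+1) n * t m := by
  obtain ⟨l, rfl⟩ : ∃ l, n = m + l + 1 := ⟨n - m - 1, by omega⟩
  rw [desc, desc, show m + l + 1 - m = l + 1 by omega, show m + l + 1 - (m+1) = l by omega,
    List.range'_succ]
  simp

theorem desc_left {m n : ℕ} (h : m ≤ n) : desc t m (n+1) = t n * desc t m n := by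
  obtain ⟨l, rfl⟩ : ∃ l, n = m + l := ⟨n - m, by omega⟩
  rw [desc, desc, show m + l + 1 - m = l + 1 by omega, show m + l - m = l by omega,
    List.range'_concat]
  simp

variable {t} {n d : ℕ}

theorem comm' (H : NilRel t n d) {i j : ℕ} (hi : 1 ≤ i) (hj : 1 ≤ j) (hi' : i ≤ n) (hj' : j ≤ n)
    (h : i + 1 < j ∨ j + 1 < i) : t i * t j = t j * t i := by
  rcases h with h | h
  · exact H.comm _ _ hi h hj'
  · exact (H.comm _ _ hj h hi').symm

theorem desc_comm (H : NilRel t n d) {j m : ℕ} (hj : 1 ≤ j) (hm : 1 ≤ m) (hjn : j ≤ n) (l : ℕ) (hl : l ≤ n + 1)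
    (hml : m ≤ l) (h : j + 1 < m ∨ l < j) : desc t m l * t j = t j * desc t m l := by
  induction l, hml using Nat.le_induction with
  | base => simp [desc_self]
  | succ l hml ih =>
    rw [desc_left t hml, mul_assoc, ih (by omega) (by omega), ← mul_assoc, ← mul_assoc,
      comm' H (by omega) (by omega) (by omega) (by omega) (by omega)]

theorem desc_gt (H : NilRel t n d) {j m : ℕ} (hm : 1 ≤ m) (hmj : m < j) (l : ℕ) (hl : l ≤ n + 1)
    (hjl : j < l) : desc t m l * t j = t (j-1) * desc t m l := by
  induction l, hjl using Nat.le_induction with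
  | base =>
    obtain ⟨i, rfl⟩ : ∃ i, j = i + 1 := ⟨j - 1, by omega⟩
    have h1 := desc_comm H (j := i + 1) (by omega) hm (by omega) i (by omega) (by omega) (by omega)
    have h2 := H.braid i (by omega) (by omega)
    simp only [Nat.succ_eq_add_one, Nat.add_sub_cancel] at *
    rw [desc_left t (by omega), desc_left t (by omega)]
    simp only [mul_assoc] at *
    rw [h1]
    simp only [← mul_assoc] at *
    rw [h2]
  | succ l hml ih =>
    rw [desc_left t (by omega), mul_assoc, ih (by omega), ← mul_assoc, ← mul_assoc,
      comm' H (by omega) (by omega) (by omega) (by omega) (by omega)]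

theorem desc_eq {m : ℕ} (hs : t m * t m = 0) (l : ℕ) (hml : m < l) :
    desc t m l * t m = 0 := by
  rw [desc_right t hml, mul_assoc, hs, mul_zero]

theorem top_zero (H : NilRel t n d) {r : ℕ} (hr : n = r + 1) (h1 : 1 ≤ r) (k : ℕ) :
    t n ^ (k + 2) * t r * t n = 0 := by
  subst hr
  have h2 := H.braid r h1 (by omega)
  have h3 := H.sq r h1 (by omega)
  calc t (r+1) ^ (k + 2) * t r * t (r+1) = t (r+1) ^ (k+1) * (t (r+1) * t r * t (r+1)) := by
        rw [pow_succ]; simp only [mul_assoc]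
    _ = t (r+1) ^ k * (t (r+1) * t r * t (r+1)) * t r := by
        conv_lhs => rw [← h2, pow_succ]
        simp only [mul_assoc]
    _ = 0 := by rw [← h2]; simp only [mul_assoc, h3, mul_zero]

theorem zero_top (H : NilRel t n d) {r : ℕ} (hr : n = r + 1) (h1 : 1 ≤ r) (k : ℕ) :
    t n * t r * t n ^ (k + 2) = 0 := by
  subst hr
  have h2 := H.braid r h1 (by omega)
  have h3 := H.sq r h1 (by omega)
  calc t (r+1) * t r * t (r+1) ^ (k + 2) = (t (r+1) * t r * t (r+1)) * t (r+1) ^ (k+1) := by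
        rw [pow_succ']; simp only [mul_assoc]
    _ = t r * (t (r+1) * t r * t (r+1)) * t (r+1) ^ k := by
        conv_lhs => rw [← h2, pow_succ']
        simp only [mul_assoc]
    _ = 0 := by rw [← h2]; simp only [← mul_assoc, h3, zero_mul]

theorem pow_comm (H : NilRel t n d) {j : ℕ} (hj : 1 ≤ j) (hjn : j + 1 < n) (k : ℕ) :
    t n ^ k * t j = t j * t n ^ k :=
  (Commute.pow_right (show Commute (t j) (t n) from H.comm j n hj hjn le_rfl) k).symm.eq

/-- `desc 1 (l+1)` squares to zero -/
theorem desc_sq (H : NilRel t n d) {l : ℕ} (hl : l ≤ n) (h1 : 1 ≤ l) (hs : t 1 * t 1 = 0) :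
    desc t 1 (l+1) * desc t 1 (l+1) = 0 := by
  have : ∀ a, 1 ≤ a → a ≤ l + 1 → desc t 1 (l+1) * desc t 1 a
      = desc t 1 (a-1) * desc t 1 (l+1) * (if a = 1 then 1 else t 1) := by
    intro a ha
    induction a, ha using Nat.le_induction with
    | base => intro _; simp [desc]
    | succ a ha ih =>
      intro hal
      rcases Nat.lt_or_ge 1 a with h | h
      · have e := desc_gt H (j := a) (m := 1) le_rfl h (l+1) (by omega) (by omega)
        have ih' := ih (by omega)
        rw [if_neg (by omega)] at ih' ⊢
        obtain ⟨b, rfl⟩ : ∃ b, a = b + 1 := ⟨a - 1, by omega⟩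
        simp only [Nat.add_sub_cancel] at *
        rw [desc_left t (show 1 ≤ b + 1 by omega), ← mul_assoc, e, mul_assoc, ih',
          desc_left t (show 1 ≤ b by omega)]
        simp only [mul_assoc]
      · obtain rfl : a = 1 := by omega
        rw [desc_left t le_rfl]
        simp [desc_self]
  rw [this (l+1) (by omega) le_rfl, if_neg (by omega), mul_assoc,
    desc_eq hs _ (by omega), mul_zero]

end desc

end NCP

namespace NCP

open Finsupp

section model
variable {N : Type} [Ring N] (t : ℕ → N) (n d : ℕ)

/-- `e_p * T_j` in the model -/
noncomputable def base (j : ℕ) (p : ℕ × ℕ) : (ℕ × ℕ) →₀ N :=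
  if 1 ≤ p.2 ∧ p.2 ≤ n ∧ p.1 < d ∧ (p.1 = 0 → p.2 = n) then
    if j = n then
      if p.2 = n then (if p.1 + 1 < d then single (p.1 + 1, n) 1 else 0)
      else if p.1 = 1 then single p (t (n - 1)) else 0
    else if p.1 = 0 then single p (t j)
    else if j + 1 = p.2 then single (p.1, j) 1
    else if j = p.2 then 0
    else if j < p.2 then single p (t j) else single p (t (j - 1))
  else 0

/-- right multiplication by `T_j` in the model -/
noncomputable def Op (j : ℕ) : Module.End N ((ℕ × ℕ) →₀ N) :=
  Finsupp.linearCombination N (base t n d j)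

theorem Op_single (j : ℕ) (p : ℕ × ℕ) (c : N) :
    Op t n d j (single p c) = c • base t n d j p := by
  simp [Op, Finsupp.linearCombination_single]

theorem R_out {j k m : ℕ} (c : N) (h : ¬ (1 ≤ m ∧ m ≤ n ∧ k < d ∧ (k = 0 → m = n))) :
    Op t n d j (single (k, m) c) = 0 := by
  rw [Op_single, base, if_neg h, smul_zero]

theorem R0 {j : ℕ} (c : N) (hn : j < n) (hd : 0 < d) :
    Op t n d j (single (0, n) c) = single (0, n) (c * t j) := by
  rw [Op_single, base, if_pos (by (try dsimp only); omega), if_neg (by omega), if_pos rfl]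
  simp

theorem Rn {k : ℕ} (c : N) (hn : 1 ≤ n) (hd : k + 1 < d) :
    Op t n d n (single (k, n) c) = single (k + 1, n) c := by
  rw [Op_single, base, if_pos (by (try dsimp only); omega), if_pos rfl, if_pos rfl, if_pos hd]
  simp

theorem Rn' {k : ℕ} (c : N) (hd : d ≤ k + 1) :
    Op t n d n (single (k, n) c) = 0 := by
  rw [Op_single, base]
  by_cases hp : 1 ≤ (k, n).2 ∧ (k, n).2 ≤ n ∧ (k, n).1 < d ∧ ((k, n).1 = 0 → (k, n).2 = n)
  swap
  · rw [if_neg hp, smul_zero]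
  rw [if_pos hp, if_pos rfl, if_pos rfl, if_neg (by (try dsimp only); omega)]
  simp

theorem Rn1 {m : ℕ} (c : N) (hm : 1 ≤ m) (hn : m < n) (hd : 1 < d) :
    Op t n d n (single (1, m) c) = single (1, m) (c * t (n - 1)) := by
  rw [Op_single, base, if_pos (by (try dsimp only); omega), if_pos rfl, if_neg (by (try dsimp only); omega),
    if_pos rfl]
  simp

theorem Rn2 {k m : ℕ} (c : N) (hn : m < n) (hd : 1 < k) :
    Op t n d n (single (k, m) c) = 0 := by
  rw [Op_single, base]
  by_cases hp : 1 ≤ (k, m).2 ∧ (k, m).2 ≤ n ∧ (k, m).1 < d ∧ ((k, m).1 = 0 → (k, m).2 = n)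
  swap
  · rw [if_neg hp, smul_zero]
  rw [if_pos hp, if_pos rfl, if_neg (by (try dsimp only); omega), if_neg (by (try dsimp only); omega)]
  simp

theorem Rdec {k j : ℕ} (c : N) (hk : 1 ≤ k) (hd : k < d) (hn : j + 1 ≤ n) :
    Op t n d j (single (k, j + 1) c) = single (k, j) c := by
  rw [Op_single, base, if_pos (by (try dsimp only); omega), if_neg (by (try dsimp only); omega),
    if_neg (by (try dsimp only); omega), if_pos rfl]
  simp

theorem Req {k j : ℕ} (c : N) (hk : 1 ≤ k) (hn : j < n) :
    Op t n d j (single (k, j) c) = 0 := by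
  rw [Op_single, base]
  by_cases hp : 1 ≤ (k, j).2 ∧ (k, j).2 ≤ n ∧ (k, j).1 < d ∧ ((k, j).1 = 0 → (k, j).2 = n)
  swap
  · rw [if_neg hp, smul_zero]
  rw [if_pos hp, if_neg (show ¬ j = n by omega), if_neg (by (try dsimp only); omega),
    if_neg (by (try dsimp only); omega), if_pos rfl]
  simp

theorem Rlt {k j m : ℕ} (c : N) (hk : 1 ≤ k) (hd : k < d) (hj : j + 1 < m) (hn : m ≤ n) :
    Op t n d j (single (k, m) c) = single (k, m) (c * t j) := by
  rw [Op_single, base, if_pos (by (try dsimp only); omega), if_neg (by (try dsimp only); omega),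
    if_neg (by (try dsimp only); omega), if_neg (by (try dsimp only); omega), if_neg (by (try dsimp only); omega),
    if_pos (by (try dsimp only); omega)]
  simp

theorem Rgt {k j m : ℕ} (c : N) (hk : 1 ≤ k) (hd : k < d) (hm : 1 ≤ m) (hj : m < j) (hn : j < n) :
    Op t n d j (single (k, m) c) = single (k, m) (c * t (j - 1)) := by
  rw [Op_single, base, if_pos (by (try dsimp only); omega), if_neg (by (try dsimp only); omega),
    if_neg (by (try dsimp only); omega), if_neg (by (try dsimp only); omega), if_neg (by (try dsimp only); omega),
    if_neg (by (try dsimp only); omega)]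
  simp

theorem end_ext {f g : Module.End N ((ℕ × ℕ) →₀ N)}
    (h : ∀ k m : ℕ, f (single (k, m) 1) = g (single (k, m) 1)) : f = g := by
  apply Finsupp.lhom_ext
  rintro ⟨k, m⟩ b
  have := congrArg (fun z => b • z) (h k m)
  simp only [← map_smul] at this
  simpa using this

variable {t}

theorem in_or_out (k m : ℕ) : ¬ (1 ≤ m ∧ m ≤ n ∧ k < d ∧ (k = 0 → m = n)) ∨
    (k = 0 ∧ m = n ∧ 1 ≤ n ∧ 0 < d) ∨ (1 ≤ k ∧ k < d ∧ 1 ≤ m ∧ m ≤ n) := by omega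

theorem sqN {r : ℕ} (H : NilRel t r 2) (i : ℕ) (h1 : 1 ≤ i) (h2 : i ≤ r) : t i * t i = 0 := by
  rcases Nat.lt_or_ge i r with h | h
  · exact H.sq i h1 h
  · obtain rfl : i = r := by omega
    rw [← pow_two]; exact H.last h1

theorem Op_sq (r : ℕ) (H : NilRel t r 2) (_hd : 2 ≤ d) (i : ℕ) (h1 : 1 ≤ i) (h2 : i < r + 1) :
    Op t (r+1) d i * Op t (r+1) d i = 0 := by
  apply end_ext
  intro k m
  simp only [Module.End.mul_apply, LinearMap.zero_apply]
  rcases in_or_out (r+1) d k m with h | ⟨rfl, rfl, h, h'⟩ | ⟨hk, hk', hm, hm'⟩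
  · rw [R_out _ _ _ _ h, map_zero]
  · simp (disch := omega) only [R0, one_mul, sqN H, single_zero]
  · rcases lt_trichotomy (i+1) m with h | h | h
    · simp (disch := omega) only [Rlt, one_mul, sqN H, single_zero]
    · subst h
      simp (disch := omega) only [Rdec, Req]
    · rcases Nat.lt_or_ge m i with h | h
      · simp (disch := omega) only [Rgt, one_mul, sqN H, single_zero]
      · obtain rfl : i = m := by omega
        simp (disch := omega) only [Req, map_zero]

theorem Op_last (r : ℕ) (H : NilRel t r 2) (hd : 2 ≤ d) :
    Op t (r+1) d (r+1) ^ d = 0 := by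
  have key : ∀ l k, 1 ≤ l → (Op t (r+1) d (r+1) ^ l) (single (k, r+1) 1) =
      if k + l < d then single (k+l, r+1) 1 else 0 := by
    intro l k hl
    induction l, hl using Nat.le_induction with
    | base =>
      rw [pow_one]
      split_ifs with h
      · rw [Rn _ _ _ _ (by omega) h]
      · rw [Rn' _ _ _ _ (by omega)]
    | succ l hl ih =>
      rw [pow_succ', Module.End.mul_apply, ih]
      split_ifs with h1 h2 h2
      · rw [Rn _ _ _ _ (by omega) (by omega)]; rfl
      · rw [Rn' _ _ _ _ (by omega)]
      · omega
      · simp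
  apply end_ext
  intro k m
  rw [LinearMap.zero_apply]
  obtain ⟨e, rfl⟩ : ∃ e, d = e + 2 := ⟨d - 2, by omega⟩
  rcases in_or_out (r+1) (e+2) k m with h | ⟨rfl, rfl, h, h'⟩ | ⟨hk, hk', hm, hm'⟩
  · rw [pow_succ, Module.End.mul_apply, R_out _ _ _ _ h, map_zero]
  · rw [key _ _ (by omega), if_neg (by omega)]
  · rcases Nat.lt_or_ge m (r+1) with h | h
    · rw [pow_add, pow_two, Module.End.mul_apply, Module.End.mul_apply]
      rcases Nat.lt_or_ge 1 k with h1 | h1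
      · simp (disch := omega) only [Rn2, map_zero]
      · obtain rfl : k = 1 := by omega
        simp (disch := omega) only [Rn1, one_mul, Nat.add_sub_cancel, sqN H, single_zero, map_zero]
    · obtain rfl : m = r + 1 := by omega
      rw [key _ _ (by omega), if_neg (by omega)]

theorem Op_comm (r : ℕ) (H : NilRel t r 2) (hd : 2 ≤ d) (i j : ℕ) (h1 : 1 ≤ i) (h2 : i + 1 < j)
    (h3 : j ≤ r + 1) :
    Op t (r+1) d i * Op t (r+1) d j = Op t (r+1) d j * Op t (r+1) d i := by
  apply end_ext
  intro k m
  simp only [Module.End.mul_apply]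
  rcases in_or_out (r+1) d k m with h | ⟨rfl, rfl, h, h'⟩ | ⟨hk, hk', hm, hm'⟩
  · rw [R_out _ _ _ _ h, R_out _ _ _ _ h, map_zero, map_zero]
  · rcases Nat.lt_or_ge j (r+1) with hj | hj
    · simp (disch := omega) only [R0, one_mul, H.comm i j]
    · obtain rfl : j = r + 1 := by omega
      simp (disch := omega) only [R0, one_mul, Rn, Rlt]
  · rcases Nat.lt_or_ge j (r+1) with hj | hj
    · rcases lt_trichotomy (i+1) m with h | h | h
      · rcases lt_trichotomy (j+1) m with g | g | g
        · simp (disch := omega) only [Rlt, one_mul, H.comm i j]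
        · subst g
          simp (disch := omega) only [Rlt, Rdec, one_mul]
        · rcases Nat.lt_or_ge m j with h | h
          · simp (disch := omega) only [Rgt, Rlt, one_mul]
            rw [H.comm i (j-1) h1 (by omega) (by omega)]
          · obtain rfl : j = m := by omega
            simp (disch := omega) only [Req, Rlt, map_zero]
      · subst h
        simp (disch := omega) only [Rdec, Rgt, one_mul]
      · rcases Nat.lt_or_ge m i with h | h
        · simp (disch := omega) only [Rgt, one_mul]
          rw [H.comm (i-1) (j-1) (by omega) (by omega) (by omega)]
        · obtain rfl : i = m := by omega
          simp (disch := omega) only [Req, Rgt, map_zero]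
    · obtain rfl : j = r + 1 := by omega
      rcases Nat.lt_or_ge m (r+1) with h' | h'
      · rcases Nat.lt_or_ge 1 k with hk1 | hk1
        · rcases lt_trichotomy (i+1) m with h | h | h
          · simp (disch := omega) only [Rn2, Rlt, map_zero]
          · subst h
            simp (disch := omega) only [Rn2, Rdec, map_zero]
          · rcases Nat.lt_or_ge m i with h | h
            · simp (disch := omega) only [Rgt, Rn2, map_zero]
            · obtain rfl : i = m := by omega
              simp (disch := omega) only [Req, Rn2, map_zero]
        · obtain rfl : k = 1 := by omega
          rcases lt_trichotomy (i+1) m with h | h | h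
          · simp (disch := omega) only [Rn1, Rlt, one_mul, Nat.add_sub_cancel]
            rw [H.comm i r h1 (by omega) (by omega)]
          · subst h
            simp (disch := omega) only [Rn1, Rdec]
          · rcases Nat.lt_or_ge m i with h | h
            · simp (disch := omega) only [Rgt, Rn1, one_mul, Nat.add_sub_cancel]
              rw [H.comm (i-1) r (by omega) (by omega) (by omega)]
            · obtain rfl : i = m := by omega
              simp (disch := omega) only [Req, Rn1, map_zero]
      · obtain rfl : m = r + 1 := by omega
        rcases Nat.lt_or_ge (k+1) d with hk1 | hk1
        · simp (disch := omega) only [Rn, Rlt]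
        · simp (disch := omega) only [Rn', Rlt, map_zero]

theorem Op_braid (r : ℕ) (H : NilRel t r 2) (hd : 2 ≤ d) (i : ℕ) (h1 : 1 ≤ i) (h2 : i + 1 ≤ r + 1) :
    Op t (r+1) d i * Op t (r+1) d (i+1) * Op t (r+1) d i
      = Op t (r+1) d (i+1) * Op t (r+1) d i * Op t (r+1) d (i+1) := by
  apply end_ext
  intro k m
  simp only [Module.End.mul_apply]
  rcases in_or_out (r+1) d k m with h | ⟨rfl, rfl, h, h'⟩ | ⟨hk, hk', hm, hm'⟩
  · simp only [R_out _ _ _ _ h, map_zero]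
  · rcases Nat.lt_or_ge i r with hj | hj
    · simp (disch := omega) only [R0, one_mul, H.braid i]
    · obtain rfl : i = r := by omega
      simp (disch := omega) only [R0, one_mul, Rn, Rdec, zero_add, Rn1, Nat.add_sub_cancel]
  · rcases Nat.lt_or_ge i r with hj | hj
    · rcases lt_trichotomy (i+2) m with h | h | h
      · simp (disch := omega) only [Rlt, one_mul, H.braid i]
      · subst h
        simp (disch := omega) only [Rlt, Rdec, Rgt, one_mul, Nat.add_sub_cancel]
      · rcases lt_trichotomy (i+1) m with h | h | h
        · omega
        · subst h
          simp (disch := omega) only [Rdec, Req, Rgt, map_zero]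
        · rcases Nat.lt_or_ge m i with h | h
          · simp (disch := omega) only [Rgt, one_mul, Nat.add_sub_cancel]
            have := H.braid (i-1) (by omega) (by omega)
            rw [show i - 1 + 1 = i by omega] at this
            rw [this]
          · obtain rfl : i = m := by omega
            simp (disch := omega) only [Req, Rgt, map_zero]
    · obtain rfl : i = r := by omega
      rcases Nat.lt_or_ge 1 k with hk1 | hk1
      · rcases lt_trichotomy (i+1) m with h | h | h
        · omega
        · subst h
          rcases Nat.lt_or_ge (k+1) d with hk1 | hk1
          · simp (disch := omega) only [Rn, Rn2, Rdec, map_zero]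
          · simp (disch := omega) only [Rn', Rn2, Rdec, map_zero]
        · rcases Nat.lt_or_ge m i with h | h
          · simp (disch := omega) only [Rgt, Rn2, map_zero]
          · obtain rfl : i = m := by omega
            simp (disch := omega) only [Req, Rn2, map_zero]
      · obtain rfl : k = 1 := by omega
        rcases lt_trichotomy (i+1) m with h | h | h
        · omega
        · subst h
          rcases Nat.lt_or_ge (1+1) d with hk1 | hk1
          · simp (disch := omega) only [Rn, Rn1, Rn2, Rdec, Req]
          · simp (disch := omega) only [Rn', Rn1, Rdec, Req, map_zero]
        · rcases Nat.lt_or_ge m i with h | h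
          · simp (disch := omega) only [Rgt, Rn1, one_mul, Nat.add_sub_cancel]
            have := H.braid (i-1) (by omega) (by omega)
            rw [show i - 1 + 1 = i by omega] at this
            rw [this]
          · obtain rfl : i = m := by omega
            simp (disch := omega) only [Req, Rn1, map_zero]

end model

end NCP

namespace NCP

open Finsupp

/-- product along the longest word on the generators `t_1, …, t_r` -/
def wl {R : Type} [Ring R] (t : ℕ → R) (r : ℕ) : R := ((longestWord (r+1)).map t).prod

section wl
variable {R : Type} [Ring R] (t : ℕ → R)

theorem wl_zero : wl t 0 = 1 := by simp [wl, longestWord]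

theorem wl_succ (r : ℕ) : wl t (r+1) = wl t r * desc t 1 (r+2) := by
  simp only [wl, desc, longestWord]
  rw [List.range_succ, List.flatMap_append, List.map_append, List.prod_append]
  simp

theorem wl_map {S : Type} [Ring S] (f : R →+* S) (s : ℕ → S) (r : ℕ)
    (h : ∀ j, 1 ≤ j → j ≤ r → f (t j) = s j) : f (wl t r) = wl s r := by
  rw [wl, wl, map_list_prod, List.map_map]
  congr 1
  apply List.map_congr_left
  intro j hj
  simp only [longestWord, List.mem_flatMap, List.mem_range, List.mem_reverse, List.mem_range'_1]
    at hj
  obtain ⟨a, h1, h2⟩ := hj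
  exact h j (by omega) (by omega)

variable {t} {n d : ℕ}

theorem wl_comm (H : NilRel t n d) {j : ℕ} (l : ℕ) (hl : l + 1 < j) (hj : j ≤ n) :
    t j * wl t l = wl t l * t j := by
  induction l with
  | zero => simp [wl_zero]
  | succ l ih =>
    rw [wl_succ, ← mul_assoc, ih (by omega), mul_assoc, mul_assoc,
      desc_comm H (by omega) le_rfl hj _ (by omega) (by omega) (by omega)]

theorem wl_left (H : NilRel t n d) (l : ℕ) (hl : l ≤ n) (hs : ∀ i, 1 ≤ i → i ≤ l → t i * t i = 0)
    (j : ℕ) (h1 : 1 ≤ j) (h2 : j ≤ l) : t j * wl t l = 0 := by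
  induction l with
  | zero => omega
  | succ l ih =>
    rw [wl_succ, ← mul_assoc]
    rcases Nat.lt_or_ge l j with h | h
    · obtain rfl : j = l + 1 := by omega
      rcases l with _ | l
      · rw [wl_zero, mul_one, desc_left t (by omega), desc_self, mul_one]
        exact hs 1 le_rfl le_rfl
      · rw [wl_succ, ← mul_assoc, wl_comm H _ (by omega) (by omega), mul_assoc (wl t l),
          ← desc_left t (by omega), mul_assoc, desc_sq H (by omega) (by omega)
            (hs 1 le_rfl (by omega)), mul_zero]
    · rw [ih (by omega) (fun i a b => hs i a (by omega)) h, zero_mul]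

theorem wl_right (H : NilRel t n d) (l : ℕ) (hl : l ≤ n) (hs : ∀ i, 1 ≤ i → i ≤ l → t i * t i = 0)
    (j : ℕ) (h1 : 1 ≤ j) (h2 : j ≤ l) : wl t l * t j = 0 := by
  induction l generalizing j with
  | zero => omega
  | succ l ih =>
    rw [wl_succ, mul_assoc]
    rcases Nat.lt_or_ge 1 j with h | h
    · rw [desc_gt H le_rfl h _ (by omega) (by omega), ← mul_assoc,
        ih (by omega) (fun i a b => hs i a (by omega)) _ (by omega) (by omega), zero_mul]
    · obtain rfl : j = 1 := by omega
      rw [desc_eq (hs 1 le_rfl (by omega)) _ (by omega), mul_zero]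

theorem prim_left (H : NilRel t n d) {s : ℕ} (hn : n = s + 2) (k : ℕ) (hk : 1 ≤ k) :
    t n * (wl t (s+1) * t n ^ k * desc t 1 n) = 0 := by
  subst hn
  have hs1 := H.sq 1 le_rfl (by omega)
  have e1 := desc_comm H (j := s+2) (m := 1) (by omega) le_rfl le_rfl (s+1) (by omega) (by omega)
    (by omega)
  have e2 : desc t 1 (s+1) * t (s+2) ^ k = t (s+2) ^ k * desc t 1 (s+1) :=
    (Commute.pow_right (show Commute (desc t 1 (s+1)) (t (s+2)) from e1) k).eq
  have e3 : t (s+2) * (wl t (s+1) * t (s+2) ^ k * desc t 1 (s+2)) = wl t s *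
      (t (s+2) * t (s+1) * t (s+2) ^ k) * (desc t 1 (s+1) * desc t 1 (s+2)) := by
    rw [wl_succ, desc_left t (show 1 ≤ s + 1 by omega)]
    calc _ = (t (s+2) * wl t s) * t (s+1) * (desc t 1 (s+1) * t (s+2) ^ k) *
          (t (s+1) * desc t 1 (s+1)) := by simp only [mul_assoc]
      _ = _ := by
          rw [e2, wl_comm H s (by omega) le_rfl]
          simp only [mul_assoc]
  rw [e3]
  rcases Nat.lt_or_ge 1 k with h | h
  · obtain ⟨e, rfl⟩ : ∃ e, k = e + 2 := ⟨k - 2, by omega⟩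
    rw [zero_top H rfl (by omega)]
    simp
  · obtain rfl : k = 1 := by omega
    have h2 := H.braid (s+1) (by omega) (by omega)
    have h3 := desc_sq H (l := s+1) (by omega) (by omega) hs1
    rw [pow_one, ← h2]
    calc _ = wl t s * (t (s+1) * t (s+2)) * ((t (s+1) * desc t 1 (s+1)) * desc t 1 (s+2)) := by
          simp only [mul_assoc]
      _ = 0 := by rw [← desc_left t (by omega), h3, mul_zero]

end wl

section rep
variable {k : Type} [CommRing k] {N : Type} [Ring N] [Algebra k N]

theorem exists_rep {t : ℕ → N} {r d : ℕ} (H : NilRel t r 2) (hd : 2 ≤ d) :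
    ∃ ρ : NCA k (r+1) d →ₐ[k] (Module.End N ((ℕ × ℕ) →₀ N))ᵐᵒᵖ,
      ∀ j, 1 ≤ j → j ≤ r + 1 → ρ (Tg k (r+1) d j) = MulOpposite.op (Op t (r+1) d j) := by
  refine exists_lift (k := k) (t := fun j => MulOpposite.op (Op t (r+1) d j)) ?_
  constructor
  · intro i h1 h2
    simp only [← MulOpposite.op_mul, ← mul_assoc, Op_braid d r H hd i h1 h2]
  · intro i j h1 h2 h3
    simp only [← MulOpposite.op_mul, Op_comm d r H hd i j h1 h2 h3]
  · intro i h1 h2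
    simp only [← MulOpposite.op_mul, Op_sq d r H hd i h1 h2, MulOpposite.op_zero]
  · intro h
    simp only [← MulOpposite.op_pow, Op_last d r H hd, MulOpposite.op_zero]

end rep

/-- the words `T_n^k T_{n-1} ⋯ T_m` -/
noncomputable def ew {R : Type} [Ring R] (t : ℕ → R) (n d : ℕ) (p : ℕ × ℕ) : R :=
  if 1 ≤ p.2 ∧ p.2 ≤ n ∧ p.1 < d ∧ (p.1 = 0 → p.2 = n) then t n ^ p.1 * desc t p.2 n else 0

section psi
variable {N R : Type} [Ring N] [Ring R] (φ : N →+* R) (t : ℕ → N) (u : ℕ → R) (r d : ℕ)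

/-- the evaluation map from the model -/
noncomputable def Psi : ((ℕ × ℕ) →₀ N) →+ R :=
  Finsupp.liftAddHom (fun p => (AddMonoidHom.mulRight (ew u (r+1) d p)).comp φ.toAddMonoidHom)

theorem Psi_single (p : ℕ × ℕ) (c : N) : Psi φ u r d (single p c) = φ c * ew u (r+1) d p := by
  simp [Psi]

variable {t u}

theorem ew_in {k m : ℕ} (h : 1 ≤ m ∧ m ≤ r + 1 ∧ k < d ∧ (k = 0 → m = r + 1)) :
    ew u (r+1) d (k, m) = u (r+1) ^ k * desc u m (r+1) := if_pos h

theorem ew_out {k m : ℕ} (h : ¬ (1 ≤ m ∧ m ≤ r + 1 ∧ k < d ∧ (k = 0 → m = r + 1))) :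
    ew u (r+1) d (k, m) = 0 := if_neg h

theorem Psi_Op (H : NilRel u (r+1) d) (hd : 2 ≤ d) (hφ : ∀ j, 1 ≤ j → j ≤ r → φ (t j) = u j)
    (j : ℕ) (h1 : 1 ≤ j) (h2 : j ≤ r + 1) (v : (ℕ × ℕ) →₀ N) :
    Psi φ u r d (Op t (r+1) d j v) = Psi φ u r d v * u j := by
  induction v using Finsupp.induction_linear with
  | zero => simp
  | add f g hf hg => simp only [map_add, hf, hg, add_mul]
  | single p c =>
    obtain ⟨k, m⟩ := p
    rcases in_or_out (r+1) d k m with h | ⟨rfl, rfl, h, h'⟩ | ⟨hk, hk', hm, hm'⟩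
    · rw [R_out _ _ _ _ h, Psi_single, ew_out _ _ h]; simp
    · rcases Nat.lt_or_ge j (r+1) with hj | hj
      · rw [R0 _ _ _ _ hj h', Psi_single, Psi_single, ew_in _ _ (by omega), map_mul,
          hφ j h1 (by omega), desc_self]
        simp
      · obtain rfl : j = r + 1 := by omega
        rw [Rn _ _ _ _ h (by omega), Psi_single, Psi_single, ew_in _ _ (by omega),
          ew_in _ _ (by omega), desc_self]
        simp
    · rcases Nat.lt_or_ge j (r+1) with hj | hj
      · rcases lt_trichotomy (j+1) m with h | h | h
        · rw [Rlt _ _ _ _ hk hk' h hm', Psi_single, Psi_single, ew_in _ _ (by omega), map_mul,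
            hφ j h1 (by omega), mul_assoc, mul_assoc, mul_assoc,
            desc_comm H h1 hm h2 _ (by omega) hm' (by omega), ← mul_assoc (_ ^ _),
            pow_comm H h1 (by omega), mul_assoc]
        · subst h
          rw [Rdec _ _ _ _ hk hk' hm', Psi_single, Psi_single, ew_in _ _ (by omega),
            ew_in _ _ (by omega), desc_right u hj]
          simp only [mul_assoc]
        · rcases Nat.lt_or_ge m j with h | h
          · rw [Rgt _ _ _ _ hk hk' hm h hj, Psi_single, Psi_single, ew_in _ _ (by omega), map_mul,
              hφ (j-1) (by omega) (by omega), mul_assoc, mul_assoc, mul_assoc,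
              desc_gt H hm h _ (by omega) hj, ← mul_assoc (_ ^ _),
              pow_comm H (by omega) (by omega), mul_assoc]
          · obtain rfl : j = m := by omega
            rw [Req _ _ _ _ hk hj, Psi_single, ew_in _ _ (by omega), mul_assoc, mul_assoc,
              desc_eq (H.sq j h1 hj) _ hj]
            simp
      · obtain rfl : j = r + 1 := by omega
        rcases Nat.lt_or_ge m (r+1) with h | h
        · have e : u (r+1) ^ k * desc u m (r+1) * u (r+1) =
              u (r+1) ^ k * u r * u (r+1) * desc u m r := by
            rw [desc_left u (by omega), mul_assoc, mul_assoc,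
              desc_comm H h1 hm h2 r (by omega) (by omega) (by omega)]
            simp only [mul_assoc]
          rcases Nat.lt_or_ge 1 k with hk1 | hk1
          · rw [Rn2 _ _ _ _ h hk1, Psi_single, ew_in _ _ (by omega), mul_assoc, e]
            obtain ⟨l, rfl⟩ : ∃ l, k = l + 2 := ⟨k - 2, by omega⟩
            rw [top_zero H rfl (by omega)]
            simp
          · obtain rfl : k = 1 := by omega
            rw [Rn1 _ _ _ _ hm h (by omega), Psi_single, Psi_single, ew_in _ _ (by omega), map_mul,
              mul_assoc _ _ (u (r+1)), e, pow_one, ← H.braid r (by omega) (by omega),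
              desc_left u (by omega), Nat.add_sub_cancel, hφ r (by omega) le_rfl]
            simp only [mul_assoc]
        · obtain rfl : m = r + 1 := by omega
          rw [Psi_single, ew_in _ _ (by omega), desc_self, mul_one, mul_assoc, ← pow_succ]
          rcases Nat.lt_or_ge (k+1) d with hk1 | hk1
          · rw [Rn _ _ _ _ h1 hk1, Psi_single, ew_in _ _ (by omega), desc_self, mul_one]
          · rw [Rn' _ _ _ _ hk1, show k + 1 = d by omega, H.last h1]
            simp

theorem Psi_smul (a : N) (v : (ℕ × ℕ) →₀ N) :
    Psi φ u r d (a • v) = φ a * Psi φ u r d v := by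
  induction v using Finsupp.induction_linear with
  | zero => simp
  | add f g hf hg => simp only [smul_add, map_add, hf, hg, mul_add]
  | single p c => rw [Finsupp.smul_single, Psi_single, Psi_single, smul_eq_mul, map_mul, mul_assoc]

end psi

theorem package (k : Type) [CommRing k] (r d : ℕ) (hd : 2 ≤ d) :
    ∃ (φ : NCA k r 2 →ₐ[k] NCA k (r+1) d)
      (π : NCA k (r+1) d →ₗ[k] ((ℕ × ℕ) →₀ NCA k r 2)),
      (∀ j, 1 ≤ j → j ≤ r → φ (Tg k r 2 j) = Tg k (r+1) d j) ∧
      π 1 = single (0, r+1) 1 ∧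
      (∀ x j, 1 ≤ j → j ≤ r + 1 →
        π (x * Tg k (r+1) d j) = Op (Tg k r 2) (r+1) d j (π x)) ∧
      (∀ a x, π (φ a * x) = a • π x) ∧
      (∀ x, Psi (φ : NCA k r 2 →+* NCA k (r+1) d) (Tg k (r+1) d) r d (π x) = x) := by
  have H := Tg_rel k r 2
  have HA := Tg_rel k (r+1) d
  have H' : NilRel (Tg k (r+1) d) r 2 := by
    refine ⟨fun i a b => HA.braid i a (by omega), fun i j a b c => HA.comm i j a b (by omega),
      fun i a b => HA.sq i a (by omega), fun a => ?_⟩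
    rw [pow_two]; exact HA.sq r a (by omega)
  obtain ⟨φ, hφ⟩ := exists_lift (k := k) H'
  obtain ⟨ρ, hρ⟩ := exists_rep (k := k) H hd
  let π : NCA k (r+1) d →ₗ[k] ((ℕ × ℕ) →₀ NCA k r 2) :=
    { toFun := fun x => (ρ x).unop (single (0, r+1) 1)
      map_add' := by intro x y; simp
      map_smul' := by intro c x; simp }
  have hπ : ∀ x, π x = (ρ x).unop (single (0, r+1) 1) := fun _ => rfl
  have hmul : ∀ x y, π (x * y) = (ρ y).unop (π x) := by
    intro x y; simp [hπ]
  refine ⟨φ, π, hφ, ?_, ?_, ?_, ?_⟩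
  · simp [hπ]
  · intro x j h1 h2
    rw [hmul, hρ j h1 h2]; rfl
  · intro a
    induction a using nca_induction with
    | hs c => intro x; rw [AlgHom.commutes, ← Algebra.smul_def, map_smul, algebraMap_smul]
    | hg j h1 h2 =>
      intro x
      rw [hφ j h1 h2, hmul, hπ (Tg k (r+1) d j), hρ j h1 (by omega), MulOpposite.unop_op,
        R0 _ _ _ _ (by omega) (by omega), hπ x, ← map_smul]
      simp
    | hm a b ha hb => intro x; rw [map_mul φ, mul_assoc, ha, hb, mul_smul]
    | ha a b ha hb => intro x; rw [map_add φ, add_mul, map_add, ha, hb, add_smul]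
  · intro x
    have key : ∀ v, Psi (φ : NCA k r 2 →+* NCA k (r+1) d) (Tg k (r+1) d) r d ((ρ x).unop v)
        = Psi (φ : NCA k r 2 →+* NCA k (r+1) d) (Tg k (r+1) d) r d v * x := by
      induction x using nca_induction with
      | hs c =>
        intro v
        have e : (ρ (algebraMap k _ c)).unop v = (algebraMap k (NCA k r 2) c) • v := by
          rw [AlgHom.commutes, algebraMap_smul]; simp
        rw [e, Psi_smul, AlgHom.coe_toRingHom, AlgHom.commutes]
        exact Algebra.commutes _ _
      | hg j h1 h2 =>
        intro v
        rw [hρ j h1 h2, MulOpposite.unop_op]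
        exact Psi_Op _ _ _ HA hd hφ j h1 h2 v
      | hm a b ha hb =>
        intro v
        rw [map_mul, MulOpposite.unop_mul, Module.End.mul_apply, hb, ha, mul_assoc]
      | ha a b ha hb =>
        intro v
        rw [map_add, MulOpposite.unop_add, LinearMap.add_apply, map_add, ha, hb, mul_add]
    rw [hπ, key, Psi_single, ew_in _ _ (by omega), desc_self]
    simp

end NCP

namespace NCP

open Finsupp

section coeff
variable {N : Type} [Ring N] {t : ℕ → N} {n d : ℕ}

theorem Op_coeff (j : ℕ) (v : (ℕ × ℕ) →₀ N) (p i : ℕ × ℕ)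
    (h : ∀ q, q ≠ i → base t n d j q p = 0) : Op t n d j v p = v i * base t n d j i p := by
  rw [Op, Finsupp.linearCombination_apply, Finsupp.sum, Finsupp.finsetSum_apply,
    Finset.sum_eq_single i]
  · simp
  · intro q _ hq
    simp [h q hq]
  · intro hi
    simp [Finsupp.notMem_support_iff.mp hi]

theorem coeff_dec {j k : ℕ} (v : (ℕ × ℕ) →₀ N) (hk : 1 ≤ k) (hd : k < d) (hj : j + 1 ≤ n) :
    Op t n d j v (k, j) = v (k, j + 1) := by
  rw [Op_coeff j v (k, j) (k, j+1)]
  · have := Rdec t n d (1 : N) hk hd hj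
    rw [Op_single, one_smul] at this
    rw [this]; simp
  · rintro ⟨a, b⟩ hq
    simp only [ne_eq, Prod.mk.injEq] at hq
    simp only [base]
    split_ifs <;> simp only [Finsupp.single_apply, Prod.mk.injEq, Finsupp.coe_zero,
      Pi.zero_apply] <;> first | rfl | (rw [if_neg (by omega)])

theorem coeff_top (v : (ℕ × ℕ) →₀ N) (hd : 2 ≤ d) (hn : 1 ≤ n) :
    Op t n d n v (1, n) = v (0, n) := by
  rw [Op_coeff n v (1, n) (0, n)]
  · have := Rn t n d (k := 0) (1 : N) hn (by omega)
    rw [Op_single, one_smul] at this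
    rw [this]; simp
  · rintro ⟨a, b⟩ hq
    simp only [ne_eq, Prod.mk.injEq] at hq
    simp only [base]
    split_ifs <;> simp only [Finsupp.single_apply, Prod.mk.injEq, Finsupp.coe_zero,
      Pi.zero_apply] <;> first | rfl | (rw [if_neg (by omega)])

theorem coeff_one (v : (ℕ × ℕ) →₀ N) {j k : ℕ} (hk : 1 ≤ k) (hd : k < d) (hj : 1 < j)
    (hn : j < n ∨ j = n ∧ k = 1) :
    Op t n d j v (k, 1) = v (k, 1) * t (j - 1) := by
  rw [Op_coeff j v (k, 1) (k, 1)]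
  · congr 1
    rcases hn with hn | ⟨rfl, rfl⟩
    · have := Rgt t n d (m := 1) (1 : N) hk hd le_rfl hj hn
      rw [Op_single, one_smul] at this
      rw [this]; simp
    · have := Rn1 t j d (m := 1) (1 : N) le_rfl hj hd
      rw [Op_single, one_smul] at this
      rw [this]; simp
  · rintro ⟨a, b⟩ hq
    simp only [ne_eq, Prod.mk.injEq] at hq
    simp only [base]
    split_ifs <;> simp only [Finsupp.single_apply, Prod.mk.injEq, Finsupp.coe_zero,
      Pi.zero_apply] <;> first | rfl | (rw [if_neg (by omega)])

theorem right_analysis {r : ℕ} (hd : 2 ≤ d) (v : (ℕ × ℕ) →₀ N)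
    (hv : ∀ j, 1 ≤ j → j ≤ r + 1 → Op t (r+1) d j v = 0) :
    v (0, r+1) = 0 ∧ (∀ k m, 1 ≤ k → k < d → 2 ≤ m → m ≤ r + 1 → v (k, m) = 0) ∧
    ∀ i, 1 ≤ i → i ≤ r → v (1, 1) * t i = 0 := by
  refine ⟨?_, ?_, ?_⟩
  · rw [← coeff_top (t := t) v hd (by omega), hv _ (by omega) le_rfl]; rfl
  · intro k m h1 h2 h3 h4
    obtain ⟨j, rfl⟩ : ∃ j, m = j + 1 := ⟨m - 1, by omega⟩
    rw [← coeff_dec (t := t) v h1 h2 h4, hv _ (by omega) (by omega)]; rfl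
  · intro i h1 h2
    have := coeff_one (t := t) (n := r+1) v (j := i + 1) le_rfl (show 1 < d by omega)
      (by omega) (by omega)
    rw [Nat.add_sub_cancel] at this
    rw [← this, hv _ (by omega) (by omega)]; rfl

end coeff

section prim
variable (k : Type) [CommRing k]

theorem pi_ew {r d : ℕ} (hd : 2 ≤ d)
    {π : NCA k (r+1) d →ₗ[k] ((ℕ × ℕ) →₀ NCA k r 2)} (h1 : π 1 = single (0, r+1) 1)
    (h2 : ∀ x j, 1 ≤ j → j ≤ r + 1 →
        π (x * Tg k (r+1) d j) = Op (Tg k r 2) (r+1) d j (π x)) (a : ℕ) (ha : 1 ≤ a) (had : a < d) :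
    π (Tg k (r+1) d (r+1) ^ a * desc (Tg k (r+1) d) 1 (r+1)) = single (a, 1) 1 := by
  have e1 : ∀ b, b < d → π (Tg k (r+1) d (r+1) ^ b) = single (b, r+1) 1 := by
    intro b
    induction b with
    | zero => intro _; rw [pow_zero, h1]
    | succ b ih =>
      intro hb
      rw [pow_succ, h2 _ _ (by omega) le_rfl, ih (by omega), Rn _ _ _ _ (by omega) hb]
  have e2 : ∀ l, l ≤ r → π (Tg k (r+1) d (r+1) ^ a * desc (Tg k (r+1) d) (r+1-l) (r+1))
      = single (a, r+1-l) 1 := by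
    intro l
    induction l with
    | zero => intro _; rw [Nat.sub_zero, desc_self, mul_one, e1 a had]
    | succ l ih =>
      intro hl
      obtain ⟨m, hm⟩ : ∃ m, m = r + 1 - (l + 1) := ⟨_, rfl⟩
      have hm' : r + 1 - l = m + 1 := by omega
      have ih' := ih (by omega)
      rw [hm'] at ih'
      rw [← hm, desc_right _ (show m < r + 1 by omega), ← mul_assoc,
        h2 _ _ (by omega) (by omega), ih', Rdec _ _ _ _ ha had (by omega)]
  have := e2 r le_rfl
  rwa [show r + 1 - r = 1 by omega] at this

theorem right_prim (r : ℕ) :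
    (∀ c : k, c • wl (Tg k r 2) r = 0 → c = 0) ∧
    ∀ x : NCA k r 2, (∀ j, 1 ≤ j → j ≤ r → x * Tg k r 2 j = 0) →
      x ∈ Submodule.span k {wl (Tg k r 2) r} := by
  induction r with
  | zero =>
    constructor
    · intro c hc
      have H : NilRel (fun _ : ℕ => (0 : k)) 0 2 := by
        constructor
        · intro i h1 h2; omega
        · intro i j h1 h2; omega
        · intro i h1 h2; omega
        · intro h; omega
      obtain ⟨f, -⟩ := exists_lift (k := k) H
      have := congrArg f hc
      simpa [wl_zero] using this
    · intro x hx0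
      clear hx0
      rw [wl_zero]
      induction x using nca_induction with
      | hs c => exact Submodule.mem_span_singleton.2 ⟨c, (Algebra.algebraMap_eq_smul_one c).symm⟩
      | hg j h1 h2 => omega
      | hm x y hx hy =>
        obtain ⟨a, rfl⟩ := Submodule.mem_span_singleton.1 hx
        obtain ⟨b, rfl⟩ := Submodule.mem_span_singleton.1 hy
        exact Submodule.mem_span_singleton.2 ⟨b * a, by simp [mul_smul]⟩
      | ha x y hx hy => exact Submodule.add_mem _ hx hy
  | succ r ih =>
    obtain ⟨φ, π, hφ, hπ1, hπr, hπl, hΨ⟩ := package k r 2 le_rfl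
    have hW : wl (Tg k (r+1) 2) (r+1) = φ (wl (Tg k r 2) r) *
        (Tg k (r+1) 2 (r+1) ^ 1 * desc (Tg k (r+1) 2) 1 (r+1)) := by
      have : φ (wl (Tg k r 2) r) = _ :=
        wl_map _ (φ : NCA k r 2 →+* NCA k (r+1) 2) (Tg k (r+1) 2) r hφ
      rw [this, wl_succ, pow_one, ← desc_left _ (by omega)]
    have hπe := pi_ew k le_rfl hπ1 hπr 1 le_rfl (by omega)
    constructor
    · intro c hc
      apply ih.1 c
      have := congrArg (fun z => π z (1, 1)) hc
      rw [hW] at this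
      simpa only [map_smul, hπl, hπe, Finsupp.smul_apply, Finsupp.single_eq_same, map_zero,
        Finsupp.coe_zero, Pi.zero_apply, smul_eq_mul, mul_one] using this
    · intro x hx
      have hv := right_analysis (t := Tg k r 2) (r := r) le_rfl (π x) (by
        intro j h1 h2
        rw [← hπr x j h1 h2, hx j h1 h2, map_zero])
      obtain ⟨v0, v1, v2⟩ := hv
      rw [← hΨ x]
      rw [Psi, Finsupp.liftAddHom_apply, Finsupp.sum]
      apply Submodule.sum_mem
      rintro ⟨a, m⟩ -
      simp only [AddMonoidHom.comp_apply, AddMonoidHom.coe_mulRight]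
      change φ (π x (a, m)) * _ ∈ _
      rcases in_or_out (r+1) 2 a m with h | ⟨rfl, rfl, h, h'⟩ | ⟨hk, hk', hm, hm'⟩
      · rw [ew_out _ _ h, mul_zero]; exact Submodule.zero_mem _
      · rw [v0, map_zero, zero_mul]; exact Submodule.zero_mem _
      · rcases Nat.lt_or_ge 1 m with h | h
        · rw [v1 a m hk hk' h hm', map_zero, zero_mul]; exact Submodule.zero_mem _
        · obtain rfl : m = 1 := by omega
          obtain rfl : a = 1 := by omega
          obtain ⟨c, hc⟩ := Submodule.mem_span_singleton.1 (ih.2 _ v2)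
          rw [← hc, map_smul, smul_mul_assoc, ew_in _ _ (by omega), ← hW]
          exact Submodule.smul_mem _ _ (Submodule.mem_span_singleton_self _)

theorem left_prim (r : ℕ) (x : NCA k r 2) (hx : ∀ j, 1 ≤ j → j ≤ r → Tg k r 2 j * x = 0) :
    x ∈ Submodule.span k {wl (Tg k r 2) r} := by
  have H := Tg_rel k r 2
  have H' : NilRel (fun j => MulOpposite.op (Tg k r 2 j)) r 2 := by
    constructor
    · intro i h1 h2
      simp only [← MulOpposite.op_mul, ← mul_assoc, H.braid i h1 h2]
    · intro i j h1 h2 h3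
      simp only [← MulOpposite.op_mul, H.comm i j h1 h2 h3]
    · intro i h1 h2
      simp only [← MulOpposite.op_mul, H.sq i h1 h2, MulOpposite.op_zero]
    · intro h
      simp only [← MulOpposite.op_pow, H.last h, MulOpposite.op_zero]
  obtain ⟨τ, hτ⟩ := exists_lift (k := k) H'
  have inv : ∀ y, (τ (τ y).unop).unop = y := by
    intro y
    induction y using nca_induction with
    | hs c => rw [AlgHom.commutes, MulOpposite.algebraMap_apply, MulOpposite.unop_op,
        AlgHom.commutes, MulOpposite.algebraMap_apply, MulOpposite.unop_op]
    | hg j h1 h2 => rw [hτ j h1 h2, MulOpposite.unop_op, hτ j h1 h2, MulOpposite.unop_op]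
    | hm a b ha hb => rw [map_mul, MulOpposite.unop_mul, map_mul, MulOpposite.unop_mul, ha, hb]
    | ha a b ha hb => rw [map_add, MulOpposite.unop_add, map_add, MulOpposite.unop_add, ha, hb]
  have flip : ∀ y : NCA k r 2, (∀ j, 1 ≤ j → j ≤ r → Tg k r 2 j * y = 0) →
      (τ y).unop ∈ Submodule.span k {wl (Tg k r 2) r} := by
    intro y hy
    apply (right_prim k r).2
    intro j h1 h2
    have := congrArg (fun z => (τ z).unop) (hy j h1 h2)
    simpa [hτ j h1 h2] using this
  obtain ⟨c, hc⟩ := Submodule.mem_span_singleton.1 (flip x hx)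
  rw [← inv x, ← hc, map_smul, MulOpposite.unop_smul]
  exact Submodule.smul_mem _ _ (flip _ (wl_left H r le_rfl (sqN H)))

theorem main_aux (r d : ℕ) (hr : 1 ≤ r) (hd : 2 ≤ d) :
    LinearIndependent k (primFam k (r+1) d) ∧
    ∀ x : NCA k (r+1) d,
      (∀ j, 1 ≤ j → j ≤ r+1 → Tg k (r+1) d j * x = 0 ∧ x * Tg k (r+1) d j = 0) ↔
        x ∈ Submodule.span k (Set.range (primFam k (r+1) d)) := by
  obtain ⟨φ, π, hφ, hπ1, hπr, hπl, hΨ⟩ := package k r d hd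
  have HA := Tg_rel k (r+1) d
  have hφW : φ (wl (Tg k r 2) r) = wl (Tg k (r+1) d) r :=
    wl_map _ (φ : NCA k r 2 →+* NCA k (r+1) d) (Tg k (r+1) d) r hφ
  have hP : ∀ a : Fin (d - 1), primFam k (r+1) d a =
      wl (Tg k (r+1) d) r * Tg k (r+1) d (r+1) ^ ((a : ℕ) + 1) * desc (Tg k (r+1) d) 1 (r+1) :=
    fun _ => rfl
  have hπP : ∀ a : Fin (d - 1), π (primFam k (r+1) d a) =
      single ((a : ℕ) + 1, 1) (wl (Tg k r 2) r) := by
    intro a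
    rw [hP, ← hφW, mul_assoc, hπl, pi_ew k hd hπ1 hπr _ (by omega) (by omega)]
    simp
  constructor
  · rw [Fintype.linearIndependent_iff]
    intro g hg a
    apply (right_prim k r).1
    have := congrArg (fun z => π z ((a : ℕ) + 1, 1)) hg
    simp only [map_sum, map_smul, hπP, map_zero, Finsupp.finsetSum_apply, Finsupp.smul_apply,
      Finsupp.coe_zero, Pi.zero_apply] at this
    rw [Finset.sum_eq_single a] at this
    · simpa using this
    · intro b _ hb
      rw [Finsupp.single_eq_of_ne, smul_zero]
      intro h
      apply hb
      simp only [Prod.mk.injEq] at h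
      ext; omega
    · simp
  · intro x
    constructor
    · intro hx
      obtain ⟨v0, v1, -⟩ := right_analysis (t := Tg k r 2) (r := r) hd (π x) (by
        intro j h1 h2
        rw [← hπr x j h1 h2, (hx j h1 h2).2, map_zero])
      rw [← hΨ x]
      rw [Psi, Finsupp.liftAddHom_apply, Finsupp.sum]
      apply Submodule.sum_mem
      rintro ⟨a, m⟩ -
      simp only [AddMonoidHom.comp_apply, AddMonoidHom.coe_mulRight]
      change φ (π x (a, m)) * _ ∈ _
      rcases in_or_out (r+1) d a m with h | ⟨rfl, rfl, h, h'⟩ | ⟨hk, hk', hm, hm'⟩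
      · rw [ew_out _ _ h, mul_zero]; exact Submodule.zero_mem _
      · rw [v0, map_zero, zero_mul]; exact Submodule.zero_mem _
      · rcases Nat.lt_or_ge 1 m with h | h
        · rw [v1 a m hk hk' h hm', map_zero, zero_mul]; exact Submodule.zero_mem _
        · obtain rfl : m = 1 := by omega
          obtain ⟨c, hc⟩ := Submodule.mem_span_singleton.1 (left_prim k r (π x (a, 1)) (by
            intro j h1 h2
            have e := hπl (Tg k r 2 j) x
            rw [hφ j h1 h2, (hx j h1 (by omega)).1, map_zero] at e
            exact (congrArg (fun z => z (a, 1)) e).symm))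
          rw [← hc, map_smul, smul_mul_assoc, ew_in _ _ (by omega), hφW, ← mul_assoc]
          apply Submodule.smul_mem
          apply Submodule.subset_span
          refine ⟨⟨a - 1, by omega⟩, ?_⟩
          rw [hP]
          simp only [show a - 1 + 1 = a by omega]
    · intro hx j h1 h2
      have hs : ∀ i, 1 ≤ i → i ≤ r → Tg k (r+1) d i * Tg k (r+1) d i = 0 :=
        fun i a b => HA.sq i a (by omega)
      induction hx using Submodule.span_induction with
      | zero => simp
      | add x y _ _ hx hy => simp [mul_add, add_mul, hx.1, hx.2, hy.1, hy.2]
      | smul c x _ hx => simp [hx.1, hx.2]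
      | mem x hx =>
        obtain ⟨a, rfl⟩ := hx
        constructor
        · rw [hP]
          rcases Nat.lt_or_ge r j with h | h
          · obtain rfl : j = r + 1 := by omega
            obtain ⟨s, rfl⟩ : ∃ s, r = s + 1 := ⟨r - 1, by omega⟩
            exact prim_left HA rfl _ (by omega)
          · rw [← mul_assoc, ← mul_assoc, wl_left HA r (by omega) hs j h1 h, zero_mul, zero_mul]
        · rw [← hΨ (primFam k (r+1) d a),
            ← Psi_Op (φ : NCA k r 2 →+* NCA k (r+1) d) r d HA hd hφ j h1 h2, hπP]
          have H := Tg_rel k r 2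
          have hW := wl_right H r le_rfl (sqN H)
          have ha := a.2
          have : Op (Tg k r 2) (r+1) d j (single ((a : ℕ) + 1, 1) (wl (Tg k r 2) r)) = 0 := by
            rcases Nat.lt_or_ge 1 j with h | h
            · rcases Nat.lt_or_ge j (r+1) with g | g
              · rw [Rgt _ _ _ _ (by omega) (by omega) le_rfl h g, hW _ (by omega) (by omega),
                  single_zero]
              · obtain rfl : j = r + 1 := by omega
                rcases Nat.eq_zero_or_pos (a : ℕ) with h0 | h0
                · rw [h0, zero_add, Rn1 _ _ _ _ le_rfl h (by omega), Nat.add_sub_cancel,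
                    hW _ hr le_rfl, single_zero]
                · rw [Rn2 _ _ _ _ h (by omega)]
            · obtain rfl : j = 1 := by omega
              rw [Req _ _ _ _ (by omega) (by omega)]
          rw [this, map_zero]

end prim

end NCP

/-- For `n ≥ 2`, `d ≥ 3`, the `k`-module of two-sided primitive elements of
`NC_A(n,d)` (those killed by left and right multiplication by every generator) is
free of rank `d-1`, spanned by `T_{w'_∘} T_n^k T_{n-1} ⋯ T_1`, `1 ≤ k ≤ d-1`. -/
theorem NCA_primitives (k : Type) [CommRing k] (n d : ℕ) (hn : 2 ≤ n) (hd : 3 ≤ d) :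
    LinearIndependent k (primFam k n d) ∧
    ∀ x : NCA k n d,
      (∀ j, 1 ≤ j → j ≤ n → Tg k n d j * x = 0 ∧ x * Tg k n d j = 0) ↔
        x ∈ Submodule.span k (Set.range (primFam k n d)) := by
  obtain ⟨r, rfl⟩ : ∃ r, n = r + 1 := ⟨n - 1, by omega⟩
  exact NCP.main_aux k r d (by omega) (by omega)
end

section
/- If k is a field, n ≥ 2 and d ≥ 3, then NC_A(n,d) is not a Frobenius algebra: there is no nondegenerate bilinear form σ on NC_A(n,d) satisfying σ(xy, z) = σ(x, yz) for all x, y, z. -/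
section AbstractRing

variable {A : Type} [Ring A]

/-- `D_m = T_m T_{m-1} ⋯ T_1`. -/
def ncD (T : ℕ → A) : ℕ → A
  | 0 => 1
  | m + 1 => T (m + 1) * ncD T m

/-- The longest element `Δ_m = Δ_{m-1} D_m`. -/
def ncDelta (T : ℕ → A) : ℕ → A
  | 0 => 1
  | m + 1 => ncDelta T m * ncD T (m + 1)

/-- The relations, with `N = n - 1`. -/
structure NCAbs (T : ℕ → A) (N : ℕ) : Prop where
  comm : ∀ i j, 1 ≤ i → i + 1 < j → j ≤ N + 1 → T i * T j = T j * T i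
  braid : ∀ i, 1 ≤ i → i ≤ N → T i * T (i + 1) * T i = T (i + 1) * T i * T (i + 1)
  sq : ∀ i, 1 ≤ i → i ≤ N → T i * T i = 0

variable {T : ℕ → A} {N : ℕ}

theorem NCAbs.commD (h : NCAbs T N) (m j : ℕ) (hj : m + 1 < j) (hj' : j ≤ N + 1) :
    ncD T m * T j = T j * ncD T m := by
  induction m with
  | zero => simp [ncD]
  | succ m ih =>
    rw [ncD, mul_assoc, ih (by omega), ← mul_assoc, h.comm (m + 1) j (by omega) hj hj', mul_assoc]

theorem NCAbs.commDelta (h : NCAbs T N) (m j : ℕ) (hj : m + 1 < j) (hj' : j ≤ N + 1) :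
    ncDelta T m * T j = T j * ncDelta T m := by
  induction m with
  | zero => simp [ncDelta]
  | succ m ih =>
    rw [ncDelta, mul_assoc, h.commD (m + 1) j hj hj', ← mul_assoc, ih (by omega), mul_assoc]

theorem NCAbs.sqD (h : NCAbs T N) (m : ℕ) (h1 : 1 ≤ m) (hm : m ≤ N) :
    ncD T m * ncD T m = 0 := by
  induction m with
  | zero => omega
  | succ m ih =>
    rcases m with _ | m
    · simpa [ncD] using h.sq 1 le_rfl hm
    · have ih' := ih (by omega) (by omega)
      have hc := h.commD m (m + 2) (by omega) (by omega)
      have hb := h.braid (m + 1) (by omega) (by omega)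
      calc ncD T (m + 1 + 1) * ncD T (m + 1 + 1)
          = T (m + 2) * T (m + 1) * (ncD T m * T (m + 2)) * ncD T (m + 1) := by
            simp only [ncD, mul_assoc]
        _ = (T (m + 2) * T (m + 1) * T (m + 2)) * ncD T m * ncD T (m + 1) := by
            rw [hc]; simp only [mul_assoc]
        _ = (T (m + 1) * T (m + 2) * T (m + 1)) * ncD T m * ncD T (m + 1) := by rw [← hb]
        _ = T (m + 1) * T (m + 2) * (ncD T (m + 1) * ncD T (m + 1)) := by
            simp only [ncD, mul_assoc]
        _ = 0 := by rw [ih', mul_zero]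

theorem NCAbs.killDelta (h : NCAbs T N) (m i : ℕ) (hi : 1 ≤ i) (him : i ≤ m) (hm : m ≤ N) :
    T i * ncDelta T m = 0 := by
  induction m with
  | zero => omega
  | succ m ih =>
    by_cases him' : i ≤ m
    · rw [ncDelta, ← mul_assoc, ih him' (by omega), zero_mul]
    · obtain rfl : i = m + 1 := by omega
      rcases m with _ | m
      · simpa [ncDelta, ncD] using h.sq 1 le_rfl hm
      · have hc := h.commDelta m (m + 2) (by omega) (by omega)
        calc T (m + 1 + 1) * ncDelta T (m + 1 + 1)
            = (T (m + 2) * ncDelta T m) * ncD T (m + 1) * ncD T (m + 2) := by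
              simp only [ncDelta, mul_assoc]
          _ = ncDelta T m * (ncD T (m + 2) * ncD T (m + 2)) := by
              rw [← hc]; simp only [ncD, mul_assoc]
          _ = 0 := by rw [h.sqD (m + 2) (by omega) hm, mul_zero]

theorem NCAbs.killLast (h : NCAbs T N) (hN : 1 ≤ N) :
    T (N + 1) * (ncDelta T N * (T (N + 1) * T (N + 1))) = 0 := by
  obtain ⟨m, rfl⟩ : ∃ m, N = m + 1 := ⟨N - 1, by omega⟩
  have hc := h.commDelta m (m + 2) (by omega) (by omega)
  have hd := h.commD m (m + 2) (by omega) (by omega)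
  have hb := h.braid (m + 1) (by omega) (by omega)
  have hs := h.sq (m + 1) (by omega) (by omega)
  calc T (m + 1 + 1) * (ncDelta T (m + 1) * (T (m + 1 + 1) * T (m + 1 + 1)))
      = (T (m + 2) * ncDelta T m) * T (m + 1) * (ncD T m * T (m + 2)) * T (m + 2) := by
        simp only [ncDelta, ncD, mul_assoc]
    _ = ncDelta T m * (T (m + 2) * T (m + 1) * T (m + 2)) * (T (m + 2) * ncD T m) := by
        rw [← hc, hd]; simp only [mul_assoc, hd]
    _ = ncDelta T m * (T (m + 1) * T (m + 2) * T (m + 1)) * (T (m + 2) * ncD T m) := by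
        rw [← hb]
    _ = ncDelta T m * T (m + 1) * (T (m + 2) * T (m + 1) * T (m + 2)) * ncD T m := by
        simp only [mul_assoc]
    _ = ncDelta T m * (T (m + 1) * T (m + 1)) * T (m + 2) * T (m + 1) * ncD T m := by
        rw [← hb]; simp only [mul_assoc]
    _ = 0 := by simp [hs]

end AbstractRing

/-! A monomial representation. -/

/-- Swap the entries at positions `i`, `i+1`. -/
def ncSwap (i : ℕ) (f : ℕ → ℕ) : ℕ → ℕ :=
  fun j => if j = i then f (i + 1) else if j = i + 1 then f i else f j

/-- The partial map by which `T_i` acts on states. -/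
def ncStep (N i : ℕ) (s : ℕ × (ℕ → ℕ)) : Option (ℕ × (ℕ → ℕ)) :=
  if i = N + 1 then (if s.1 = 1 ∨ s.1 = 2 then some (s.1 + 1, s.2) else none)
  else if i = N ∧ s.1 = 0 then some (1, s.2)
  else if i = N ∧ s.1 < 3 then none
  else if i + 1 = N ∧ s.1 = 0 then none
  else if s.2 i < s.2 (i + 1) then some (s.1, ncSwap i s.2) else none

/-- The linear operator attached to a partial map. -/
noncomputable def ncOp (k : Type) [Field k] {S : Type} (p : S → Option S) :
    Module.End k (S →₀ k) :=
  Finsupp.linearCombination k (fun s => (p s).elim 0 (fun t => Finsupp.single t 1))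

theorem ncOp_single (k : Type) [Field k] {S : Type} (p : S → Option S) (s : S) :
    ncOp k p (Finsupp.single s 1) = (p s).elim 0 (fun t => Finsupp.single t 1) := by
  simp [ncOp]

theorem ncOp_mul (k : Type) [Field k] {S : Type} (p q : S → Option S) :
    ncOp k p * ncOp k q = ncOp k (fun s => (q s).bind p) := by
  apply Finsupp.lhom_ext'
  intro s
  apply LinearMap.ext_ring
  simp only [LinearMap.comp_apply, Finsupp.lsingle_apply, Module.End.mul_apply, ncOp_single]
  cases q s <;> simp [ncOp_single]

theorem ncOp_none (k : Type) [Field k] {S : Type} :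
    ncOp k (fun _ : S => none) = 0 := by
  apply Finsupp.lhom_ext'
  intro s
  apply LinearMap.ext_ring
  simp [ncOp_single]

theorem ncSwap_comm (i j : ℕ) (h : i + 1 < j) (f : ℕ → ℕ) :
    ncSwap i (ncSwap j f) = ncSwap j (ncSwap i f) := by
  funext x; simp only [ncSwap]; grind

theorem ncSwap_braid (i : ℕ) (f : ℕ → ℕ) :
    ncSwap i (ncSwap (i + 1) (ncSwap i f)) = ncSwap (i + 1) (ncSwap i (ncSwap (i + 1) f)) := by
  funext x; simp only [ncSwap]; grind

theorem ncSwap_left (i : ℕ) (f : ℕ → ℕ) : ncSwap i f i = f (i + 1) := by simp [ncSwap]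

theorem ncSwap_right (i : ℕ) (f : ℕ → ℕ) : ncSwap i f (i + 1) = f i := by simp [ncSwap]

theorem ncSwap_ne (i j : ℕ) (f : ℕ → ℕ) (h : j ≠ i) (h' : j ≠ i + 1) : ncSwap i f j = f j := by
  simp [ncSwap, h, h']

theorem ncStep_sq (N i : ℕ) (h : i ≤ N) :
    (fun s => (ncStep N i s).bind (ncStep N i)) = fun _ => none := by
  funext ⟨t, f⟩
  have h1 := ncSwap_left i f
  have h2 := ncSwap_right i f
  simp only [ncStep]
  split_ifs <;> simp <;> grind [ncStep]

theorem ncStep_comm (N i j : ℕ) (h : i + 1 < j) (hj : j ≤ N + 1) :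
    (fun s => (ncStep N j s).bind (ncStep N i)) = fun s => (ncStep N i s).bind (ncStep N j) := by
  funext ⟨t, f⟩
  have h1 := ncSwap_ne i j f (by omega) (by omega)
  have h2 := ncSwap_ne i (j + 1) f (by omega) (by omega)
  have h3 := ncSwap_ne j i f (by omega) (by omega)
  have h4 := ncSwap_ne j (i + 1) f (by omega) (by omega)
  have h5 := ncSwap_comm i j h f
  simp only [ncStep]
  split_ifs <;> simp <;> grind [ncStep]

theorem ncStep_braid (N i : ℕ) (h : i ≤ N) :
    (fun s => (ncStep N i s).bind (fun s => (ncStep N (i + 1) s).bind (ncStep N i))) =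
    fun s => (ncStep N (i + 1) s).bind (fun s => (ncStep N i s).bind (ncStep N (i + 1))) := by
  funext ⟨t, f⟩
  have h5 := ncSwap_braid i f
  have a1 : ∀ f, ncSwap i f i = f (i + 1) := ncSwap_left i
  have a2 : ∀ f, ncSwap i f (i + 1) = f i := ncSwap_right i
  have a3 : ∀ f, ncSwap i f (i + 2) = f (i + 2) :=
    fun f => ncSwap_ne i (i + 2) f (by omega) (by omega)
  have b1 : ∀ f, ncSwap (i + 1) f (i + 1) = f (i + 2) := ncSwap_left (i + 1)
  have b2 : ∀ f, ncSwap (i + 1) f (i + 2) = f (i + 1) := ncSwap_right (i + 1)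
  have b3 : ∀ f, ncSwap (i + 1) f i = f i :=
    fun f => ncSwap_ne (i + 1) i f (by omega) (by omega)
  by_cases e : i = N
  · subst e
    rcases Nat.lt_or_ge t 3 with ht | ht
    · interval_cases t <;> simp [ncStep] <;> grind [ncStep]
    · simp only [ncStep]
      split_ifs <;> simp <;> grind [ncStep]
  by_cases e' : i + 1 = N
  · subst e'
    rcases Nat.lt_or_ge t 3 with ht | ht
    · interval_cases t <;> simp [ncStep] <;> split_ifs <;> simp <;> grind [ncStep]
    · have r1 : ∀ f, ncStep (i + 1) i (t, f) =
          if f i < f (i + 1) then some (t, ncSwap i f) else none := by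
        intro f; simp only [ncStep]; grind
      have r2 : ∀ f, ncStep (i + 1) (i + 1) (t, f) =
          if f (i + 1) < f (i + 2) then some (t, ncSwap (i + 1) f) else none := by
        intro f; simp only [ncStep]; grind
      simp only [r1, r2]
      split_ifs <;> simp [r1, r2, a1, a2, a3, b1, b3] <;> grind
  by_cases e2 : i + 2 = N ∧ t = 0
  · obtain ⟨rfl, rfl⟩ := e2
    simp [ncStep]
  · have r1 : ∀ f, ncStep N i (t, f) =
        if f i < f (i + 1) then some (t, ncSwap i f) else none := by
      intro f; simp only [ncStep]; grind
    have r2 : ∀ f, ncStep N (i + 1) (t, f) =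
        if f (i + 1) < f (i + 2) then some (t, ncSwap (i + 1) f) else none := by
      intro f; simp only [ncStep]; grind
    simp only [r1, r2]
    split_ifs <;> simp [r1, r2, a1, a2, a3, b1, b3] <;> grind

theorem ncStep_cube (N : ℕ) :
    (fun s => (ncStep N (N + 1) s).bind
      (fun s => (ncStep N (N + 1) s).bind (ncStep N (N + 1)))) = fun _ => none := by
  funext ⟨t, f⟩
  by_cases h1 : t = 1
  · simp [ncStep, h1]
  by_cases h2 : t = 2
  · simp [ncStep, h2]
  simp [ncStep, h1, h2]

/-- The representation. -/
noncomputable def ncRep (k : Type) [Field k] (N d : ℕ) (hd : 3 ≤ d) :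
    NCA k (N + 1) d →ₐ[k] Module.End k ((ℕ × (ℕ → ℕ)) →₀ k) :=
  RingQuot.liftAlgHom k ⟨FreeAlgebra.lift k (fun i : Fin (N + 1) => ncOp k (ncStep N (i + 1))), by
    intro x y h
    induction h with
    | braid i j h =>
      have hj : (j : ℕ) ≤ N := by omega
      rw [← h] at hj
      simp only [map_mul, FreeAlgebra.lift_ι_apply, ← h, ncOp_mul, mul_assoc]
      simp only [Option.bind_assoc]
      rw [ncStep_braid N (i + 1) hj]
    | comm i j h =>
      simp only [map_mul, FreeAlgebra.lift_ι_apply, ncOp_mul]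
      rw [ncStep_comm N (i + 1) (j + 1) (by omega) (by omega)]
    | sq i h =>
      simp only [map_mul, FreeAlgebra.lift_ι_apply, pow_two, ncOp_mul, map_zero]
      rw [ncStep_sq N (i + 1) (by omega), ncOp_none]
    | last i h =>
      have hi : (i : ℕ) = N := by omega
      simp only [map_pow, FreeAlgebra.lift_ι_apply, map_zero, hi]
      refine pow_eq_zero_of_le hd ?_
      rw [pow_succ, pow_two, ncOp_mul, ncOp_mul, ncStep_cube, ncOp_none]⟩

theorem ncRep_Tg (k : Type) [Field k] (N d : ℕ) (hd : 3 ≤ d) (j : ℕ) (h1 : 1 ≤ j)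
    (h2 : j ≤ N + 1) : ncRep k N d hd (Tg k (N + 1) d j) = ncOp k (ncStep N j) := by
  rw [Tg, dif_pos ⟨h1, h2⟩, ncRep, RingQuot.liftAlgHom_mkAlgHom_apply, FreeAlgebra.lift_ι_apply]
  simp only [Nat.sub_add_cancel h1]

theorem ncRep_step (k : Type) [Field k] (N d : ℕ) (hd : 3 ≤ d) (j : ℕ) (h1 : 1 ≤ j)
    (h2 : j ≤ N + 1) (s t) (h : ncStep N j s = some t) :
    ncRep k N d hd (Tg k (N + 1) d j) (Finsupp.single s 1) = Finsupp.single t 1 := by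
  rw [ncRep_Tg k N d hd j h1 h2, ncOp_single, h]; rfl

theorem ncRep_D (k : Type) [Field k] (N d : ℕ) (hd : 3 ≤ d) (m : ℕ) (hm : m ≤ N) (f : ℕ → ℕ)
    (hf : ∀ j, 2 ≤ j → j ≤ m + 1 → f 1 < f j) :
    ∃ g : ℕ → ℕ, ncRep k N d hd (ncD (Tg k (N + 1) d) m) (Finsupp.single (3, f) 1) =
      Finsupp.single (3, g) 1 ∧ (∀ j, 1 ≤ j → j ≤ m → g j = f (j + 1)) ∧ g (m + 1) = f 1 ∧
      ∀ j, m + 1 < j → g j = f j := by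
  induction m with
  | zero => exact ⟨f, by simp [ncD], by intros; omega, rfl, fun _ _ => rfl⟩
  | succ m ih =>
    obtain ⟨g, hg, h1, h2, h3⟩ := ih (by omega) (fun j hj hj' => hf j hj (by omega))
    have hlt : g (m + 1) < g (m + 2) := by
      rw [h2, h3 _ (by omega)]; exact hf _ (by omega) (by omega)
    refine ⟨ncSwap (m + 1) g, ?_, ?_, ?_, ?_⟩
    · rw [ncD, map_mul, Module.End.mul_apply, hg]
      apply ncRep_step k N d hd _ (by omega) (by omega)
      simp only [ncStep]
      grind
    · intro j hj hj'
      by_cases e : j = m + 1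
      · subst e; rw [ncSwap_left]; exact h3 _ (by omega)
      · rw [ncSwap_ne _ _ _ e (by omega)]; exact h1 j hj (by omega)
    · rw [ncSwap_right, h2]
    · intro j hj
      rw [ncSwap_ne _ _ _ (by omega) (by omega)]; exact h3 j (by omega)

theorem ncRep_Delta (k : Type) [Field k] (N d : ℕ) (hd : 3 ≤ d) (m : ℕ) (hm : m ≤ N) (f : ℕ → ℕ)
    (hf : ∀ i j, 1 ≤ i → i < j → j ≤ m + 1 → f i < f j) :
    ∃ g : ℕ → ℕ, ncRep k N d hd (ncDelta (Tg k (N + 1) d) m) (Finsupp.single (3, f) 1) =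
      Finsupp.single (3, g) 1 := by
  induction m generalizing f with
  | zero => exact ⟨f, by simp [ncDelta]⟩
  | succ m ih =>
    obtain ⟨g, hg, h1, -, -⟩ := ncRep_D k N d hd (m + 1) hm f
      (fun j hj hj' => hf 1 j le_rfl (by omega) hj')
    rw [ncDelta, map_mul, Module.End.mul_apply, hg]
    apply ih (by omega)
    intro i j hi hij hj
    rw [h1 i hi (by omega), h1 j (by omega) hj]
    exact hf _ _ (by omega) (by omega) (by omega)

theorem ncNonzero (k : Type) [Field k] (N d : ℕ) (hN : 1 ≤ N) (hd : 3 ≤ d) :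
    ncDelta (Tg k (N + 1) d) N * (Tg k (N + 1) d (N + 1) * Tg k (N + 1) d (N + 1)) *
      Tg k (N + 1) d N ≠ 0 := by
  intro h
  have h' := congrArg (fun a => ncRep k N d hd a (Finsupp.single (0, fun j => j) 1)) h
  simp only [map_mul, map_zero, Module.End.mul_apply, LinearMap.zero_apply] at h'
  rw [ncRep_step k N d hd N hN (by omega) _ (1, fun j => j) (by simp [ncStep]),
    ncRep_step k N d hd (N + 1) (by omega) (by omega) _ (2, fun j => j) (by simp [ncStep]),
    ncRep_step k N d hd (N + 1) (by omega) (by omega) _ (3, fun j => j) (by simp [ncStep])] at h'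
  obtain ⟨g, hg⟩ := ncRep_Delta k N d hd N le_rfl (fun j => j) (fun _ _ _ h _ => h)
  rw [hg] at h'
  simp at h'

theorem ncAbs_Tg (k : Type) [Field k] (N d : ℕ) : NCAbs (Tg k (N + 1) d) N := by
  constructor
  · intro i j hi hij hj
    rw [Tg, Tg, dif_pos ⟨hi, by omega⟩, dif_pos ⟨by omega, hj⟩, ← map_mul, ← map_mul]
    exact RingQuot.mkAlgHom_rel k (NCRel.comm _ _ (by simp only; omega))
  · intro i hi hiN
    rw [Tg, Tg, dif_pos ⟨hi, by omega⟩, dif_pos ⟨by omega, by omega⟩]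
    simp only [← map_mul]
    exact RingQuot.mkAlgHom_rel k (NCRel.braid _ _ (by simp only; omega))
  · intro i hi hiN
    rw [Tg, dif_pos ⟨hi, by omega⟩, ← map_mul, ← pow_two,
      RingQuot.mkAlgHom_rel k (NCRel.sq _ (by simp only; omega)), map_zero]

theorem nc_scalar (k : Type) [Field k] (N d : ℕ) (z : NCA k (N + 1) d)
    (hz : ∀ j, 1 ≤ j → j ≤ N + 1 → Tg k (N + 1) d j * z = 0) (y : NCA k (N + 1) d) :
    ∃ c : k, y * z = c • z := by
  obtain ⟨y, rfl⟩ := RingQuot.mkAlgHom_surjective k (NCRel k (N + 1) d) y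
  induction y using FreeAlgebra.induction with
  | grade0 r => exact ⟨r, by rw [AlgHom.commutes, Algebra.smul_def]⟩
  | grade1 i =>
    refine ⟨0, ?_⟩
    have := hz (i + 1) (by omega) (by omega)
    rw [Tg, dif_pos ⟨by omega, by omega⟩] at this
    simpa using this
  | mul a b ha hb =>
    obtain ⟨c, hc⟩ := ha
    obtain ⟨e, he⟩ := hb
    exact ⟨e * c, by rw [map_mul, mul_assoc, he, mul_smul_comm, hc, smul_smul]⟩
  | add a b ha hb =>
    obtain ⟨c, hc⟩ := ha
    obtain ⟨e, he⟩ := hb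
    exact ⟨c + e, by rw [map_add, add_mul, hc, he, add_smul]⟩

/-- For `k` a field, `n ≥ 2` and `d ≥ 3`, the algebra `NC_A(n,d)` is not Frobenius:
it admits no nondegenerate bilinear form `σ` with `σ(xy, z) = σ(x, yz)`. -/
theorem NCA_not_frobenius (k : Type) [Field k] (n d : ℕ) (hn : 2 ≤ n) (hd : 3 ≤ d) :
    ¬ ∃ σ : NCA k n d →ₗ[k] NCA k n d →ₗ[k] k,
        (∀ x y z : NCA k n d, σ (x * y) z = σ x (y * z)) ∧
        (∀ x : NCA k n d, (∀ y, σ x y = 0) → x = 0) ∧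
        (∀ y : NCA k n d, (∀ x, σ x y = 0) → y = 0) := by
  rintro ⟨σ, hσ, -, hnd⟩
  obtain ⟨N, rfl⟩ : ∃ N, n = N + 1 := ⟨n - 1, by omega⟩
  have hN : 1 ≤ N := by omega
  have hA := ncAbs_Tg k N d
  have key : ∀ z : NCA k (N + 1) d, (∀ j, 1 ≤ j → j ≤ N + 1 → Tg k (N + 1) d j * z = 0) →
      σ 1 z = 0 → z = 0 := by
    intro z hz h0
    apply hnd
    intro y
    obtain ⟨c, hc⟩ := nc_scalar k N d z hz y
    rw [← one_mul y, hσ, hc, map_smul, h0, smul_zero]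
  have hne := ncNonzero k N d hN hd
  set x := ncDelta (Tg k (N + 1) d) N * (Tg k (N + 1) d (N + 1) * Tg k (N + 1) d (N + 1)) with hx
  set t := Tg k (N + 1) d N with ht
  have htt : t * t = 0 := hA.sq N hN le_rfl
  have hk : ∀ j, 1 ≤ j → j ≤ N + 1 → Tg k (N + 1) d j * x = 0 := by
    intro j hj hj'
    by_cases e : j = N + 1
    · subst e; exact hA.killLast hN
    · rw [hx, ← mul_assoc, hA.killDelta N j hj (by omega) le_rfl, zero_mul]
  have hk' : ∀ j, 1 ≤ j → j ≤ N + 1 → Tg k (N + 1) d j * (x * t) = 0 := by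
    intro j hj hj'
    rw [← mul_assoc, hk j hj hj', zero_mul]
  have h0 : σ 1 (x * t) • x - σ 1 x • (x * t) = 0 := by
    apply key
    · intro j hj hj'
      rw [mul_sub, mul_smul_comm, mul_smul_comm, hk j hj hj', hk' j hj hj']
      simp
    · simp only [map_sub, map_smul, smul_eq_mul]; ring
  have h1 : σ 1 (x * t) • (x * t) = 0 := by
    have := congrArg (· * t) h0
    simpa [sub_mul, smul_mul_assoc, mul_assoc, htt] using this
  rcases smul_eq_zero.1 h1 with h2 | h2
  · exact hne (key _ hk' h2)
  · exact hne h2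
end
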